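/- arXiv:1507.05459 — 5 statements merged into one kernel-verified Lean document; each statement's English description precedes it below -/
import Mathlib

section
/- Let (R,m,K) be a standard graded K-algebra of characteristic p > 0 which is F-finite and F-pure, and let J ⊆ R be a homogeneous ideal. Then p · b_J(p^e) ≤ b_J(p^{e+1}) for every e ∈ N, where b_J(p^e) = max{r : J^r ⊄ I_e(R)}. -/
/-!
Core definitions: standard graded algebras, Koszul-colimit model of graded local
cohomology nonvanishing, Frobenius splittings, F-purity, F-thresholds.
-/

open Filter

namespace FT

variable {R : Type*}

/-- Component of the (cochain) Koszul complex on `n` elements with values in `M`. -/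
abbrev KC (n : ℕ) (M : Type*) (k : ℕ) : Type _ :=
  {s : Finset (Fin n) // s.card = k} → M

/-- The Koszul cochain differential on the complex `K^•(f₁,…,fₙ; M)`. -/
def kd [CommRing R] {n : ℕ} (M : Type*) [AddCommGroup M] [Module R M]
    (f : Fin n → R) (k : ℕ) : KC n M k →ₗ[R] KC n M (k + 1) where
  toFun ω s := ∑ i ∈ s.1.attach,
    ((-1 : ℤ) ^ (s.1.filter (fun j => j < i.1)).card) •
      (f i.1 • ω ⟨s.1.erase i.1, by simp [Finset.card_erase_of_mem i.2, s.2]⟩)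
  map_add' a b := by
    funext s
    simp [smul_add, Finset.sum_add_distrib]
  map_smul' r a := by
    funext s
    simp only [Pi.smul_apply, RingHom.id_apply, Finset.smul_sum]
    refine Finset.sum_congr rfl fun i _ => ?_
    rw [smul_comm (f i.1) r, smul_comm ((-1 : ℤ) ^ (s.1.filter (fun j => j < i.1)).card) r]

/-- Transition maps of the direct system of Koszul complexes,
`K^•(f₁ᵗ,…,fₙᵗ; M) → K^•(f₁^{t+c},…,fₙ^{t+c}; M)`: on the component indexed by `s`
it is multiplication by `(∏_{i ∈ s} f i)^c`. -/
def ktr [CommRing R] {n : ℕ} (M : Type*) [AddCommGroup M] [Module R M]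
    (f : Fin n → R) (c k : ℕ) : KC n M k →ₗ[R] KC n M k where
  toFun ω s := (∏ i ∈ s.1, f i) ^ c • ω s
  map_add' a b := by funext s; simp
  map_smul' r a := by
    funext s
    simp only [Pi.smul_apply, RingHom.id_apply]
    rw [smul_comm]

/-- Koszul cocycles. -/
def koszulZ [CommRing R] {n : ℕ} (M : Type*) [AddCommGroup M] [Module R M]
    (f : Fin n → R) (i : ℕ) : Submodule R (KC n M i) :=
  LinearMap.ker (kd M f i)

/-- Koszul coboundaries. -/
def koszulB [CommRing R] {n : ℕ} (M : Type*) [AddCommGroup M] [Module R M]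
    (f : Fin n → R) : (i : ℕ) → Submodule R (KC n M i)
  | 0 => ⊥
  | (i + 1) => LinearMap.range (kd M f i)

end FT

namespace FT

variable {K R : Type*}

section Graded

variable [Field K] [CommRing R] [Algebra K R]

/-- Extension of a grading `𝒜 : ℕ → Submodule K R` to integer degrees (zero in
negative degrees). -/
def zdeg (𝒜 : ℕ → Submodule K R) (j : ℤ) : Submodule K R :=
  if 0 ≤ j then 𝒜 j.toNat else ⊥

/-- `ω` is a homogeneous element of (internal) degree `j` of the `k`-th component of the
Koszul complex `K^•(x₁ᵗ,…,xₙᵗ; R)`, where the `xᵢ` have degree one; the component of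
`K^k` indexed by a subset `s` is `R(-t·k)`, so it consists of elements of `R` of degree
`j + t·k`. -/
def KCdeg (𝒜 : ℕ → Submodule K R) (t k : ℕ) (j : ℤ) {n : ℕ} (ω : KC n R k) : Prop :=
  ∀ s, ω s ∈ zdeg 𝒜 (j + t * k)

/-- `lcNonzero K R 𝒜 i j` says that the degree-`j` graded piece of the `i`-th local
cohomology module `H^i_m(R)` (with support in the irrelevant maximal ideal
`m = (𝒜 1)·R`) is nonzero.  Local cohomology is computed here as the direct limit over
`t` of the cohomology of the Koszul complexes `K^•(x₁ᵗ,…,xₙᵗ; R)` on a family of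
degree-one generators of `m`; a class of degree `j` is nonzero in the limit iff it is
represented by a homogeneous cocycle of degree `j` at some stage `t` whose image at
every later stage is not a coboundary. -/
def lcNonzero (K : Type*) (R : Type*) [Field K] [CommRing R] [Algebra K R]
    (𝒜 : ℕ → Submodule K R) (i : ℕ) (j : ℤ) : Prop :=
  ∃ (n : ℕ) (x : Fin n → R), (∀ l, x l ∈ 𝒜 1) ∧
    Ideal.span (Set.range x) = Ideal.span ((𝒜 1 : Submodule K R) : Set R) ∧
    ∃ (t : ℕ) (ω : KC n R i), 0 < t ∧
      ω ∈ koszulZ R (fun l => x l ^ t) i ∧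
      KCdeg 𝒜 t i j ω ∧
      ∀ c : ℕ, ktr R x c i ω ∉ koszulB R (fun l => x l ^ (t + c)) i

/-- A standard graded `K`-algebra: `R = ⊕ 𝒜 i` with `𝒜 0 = K` and `R` generated over
`K` by the finite-dimensional piece `𝒜 1`. -/
structure IsStandardGraded (K : Type*) (R : Type*) [Field K] [CommRing R] [Algebra K R]
    (𝒜 : ℕ → Submodule K R) : Prop where
  internal : DirectSum.IsInternal 𝒜
  mul_le : ∀ i j, 𝒜 i * 𝒜 j ≤ 𝒜 (i + j)
  deg0 : 𝒜 0 = 1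
  gen1 : Algebra.adjoin K ((𝒜 1 : Submodule K R) : Set R) = ⊤
  fg1 : (𝒜 1).FG

/-- The irrelevant maximal ideal of a standard graded algebra, generated by the
degree-one piece. -/
def irrIdeal (𝒜 : ℕ → Submodule K R) : Ideal R :=
  Ideal.span ((𝒜 1 : Submodule K R) : Set R)

/-- A homogeneous ideal: an ideal generated by homogeneous elements. -/
def IsHomogIdeal (𝒜 : ℕ → Submodule K R) (J : Ideal R) : Prop :=
  ∃ S : Set R, (∀ s ∈ S, ∃ d, s ∈ 𝒜 d) ∧ J = Ideal.span S

end Graded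

section Frobenius

variable [CommRing R]

/-- Under the identification of `R`-linear maps `R^{1/p^e} → R` with additive maps
`φ : R → R` satisfying `φ(r^{p^e}·x) = r·φ(x)`, the statement `FSplitsAt R p e f` says
that the inclusion of `R`-modules `f^{1/p^e}·R ⊆ R^{1/p^e}` splits, i.e. there is an
`R`-linear map `R^{1/p^e} → R` sending `f^{1/p^e}` to `1`. -/
def FSplitsAt (R : Type*) [CommRing R] (p e : ℕ) (f : R) : Prop :=
  ∃ φ : R →+ R, (∀ r x : R, φ (r ^ p ^ e * x) = r * φ x) ∧ φ f = 1

/-- `R` is `F`-pure (equivalently, for `F`-finite rings, `F`-split): the Frobenius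
`R → R^{1/p}` splits as a map of `R`-modules. -/
def IsFPureRing (R : Type*) [CommRing R] (p : ℕ) : Prop :=
  FSplitsAt R p 1 1

/-- `R` is `F`-finite: `R` is a finitely generated module over itself via the Frobenius
endomorphism, i.e. `R^{1/p}` is a finitely generated `R`-module. -/
def IsFFinite (R : Type*) [CommRing R] (p : ℕ) : Prop :=
  ∃ s : Finset R, ∀ x : R, ∃ c : R → R, x = ∑ y ∈ s, c y ^ p * y

/-- `R` is strongly `F`-regular: for every nonzero `f` there is `e` such that
`f^{1/p^e}·R → R^{1/p^e}` splits. -/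
def IsStronglyFRegular (R : Type*) [CommRing R] (p : ℕ) : Prop :=
  ∀ f : R, f ≠ 0 → ∃ e : ℕ, FSplitsAt R p e f

/-- The set of nonnegative reals `λ` such that the pair `(R, I^λ)` is `F`-pure. -/
def fptSet (R : Type*) [CommRing R] (p : ℕ) (I : Ideal R) : Set ℝ :=
  {lam : ℝ | 0 ≤ lam ∧
    ∀ᶠ e in atTop, ∃ f ∈ I ^ ⌊((p : ℝ) ^ e - 1) * lam⌋₊, FSplitsAt R p e f}

/-- The `F`-pure threshold of an ideal `I` (for `I` the irrelevant/maximal ideal this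
is the `F`-pure threshold of `R`). -/
noncomputable def fpt (R : Type*) [CommRing R] (p : ℕ) (I : Ideal R) : ℝ :=
  sSup (fptSet R p I)

/-- The set of `R`-linear maps `R^{1/p^e} → R`, identified with additive maps
`φ : R → R` satisfying `φ(r^{p^e}·x) = r·φ(x)`. -/
def frobHoms (R : Type*) [CommRing R] (p e : ℕ) : Set (R →+ R) :=
  {φ | ∀ r x : R, φ (r ^ p ^ e * x) = r * φ x}

/-- The ideal `I_e(R) = {r ∈ R | φ(r^{1/p^e}) ∈ m for all φ ∈ Hom_R(R^{1/p^e}, R)}`. -/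
def Ie (R : Type*) [CommRing R] (p : ℕ) (m : Ideal R) (e : ℕ) : Ideal R where
  carrier := {r : R | ∀ φ ∈ frobHoms R p e, φ r ∈ m}
  zero_mem' := by
    intro φ _
    simp
  add_mem' := by
    intro a b ha hb φ hφ
    rw [map_add]
    exact m.add_mem (ha φ hφ) (hb φ hφ)
  smul_mem' := by
    intro r x hx φ hφ
    have hψ : (φ.comp (AddMonoidHom.mulLeft r)) ∈ frobHoms R p e := by
      intro c y
      simp only [AddMonoidHom.coe_comp, AddMonoidHom.coe_mulLeft, Function.comp_apply]
      rw [mul_left_comm, hφ]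
    simpa using hx _ hψ

/-- The splitting prime `𝒫(R) = ⋂ₑ I_e(R)`. -/
def splittingPrime (R : Type*) [CommRing R] (p : ℕ) (m : Ideal R) : Ideal R :=
  ⨅ e : ℕ, Ie R p m e

/-- `b_J(p^e) = max{r | J^r ⊄ I_e(R)}`. -/
noncomputable def bJ (R : Type*) [CommRing R] (p : ℕ) (m J : Ideal R) (e : ℕ) : ℕ :=
  sSup {r : ℕ | ¬ J ^ r ≤ Ie R p m e}

/-- The Frobenius power `I^{[q]}`, generated by the `q`-th powers of the elements
of `I`. -/
def frobeniusPower (I : Ideal R) (q : ℕ) : Ideal R :=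
  Ideal.span ((fun x : R => x ^ q) '' (I : Set R))

/-- `ν_I(q) = max{r | I^r ⊄ m^{[q]}}`. -/
noncomputable def nu (m : Ideal R) (I : Ideal R) (q : ℕ) : ℕ :=
  sSup {r : ℕ | ¬ I ^ r ≤ frobeniusPower m q}

/-- An ideal `J` is compatible if `φ(J^{1/p^e}) ⊆ J` for every `e` and every
`φ ∈ Hom_R(R^{1/p^e}, R)`. -/
def IsCompatibleIdeal (R : Type*) [CommRing R] (p : ℕ) (J : Ideal R) : Prop :=
  ∀ e : ℕ, ∀ φ ∈ frobHoms R p e, ∀ x ∈ J, φ x ∈ J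

end Frobenius

section RegSeq

variable [CommRing R]

/-- `f 0, …, f (r-1)` is a regular sequence on `R`. -/
def IsRegularSeq (R : Type*) [CommRing R] {r : ℕ} (f : Fin r → R) : Prop :=
  (∀ (k : Fin r) (x : R), f k * x ∈ Ideal.span (f '' {j | j < k}) →
      x ∈ Ideal.span (f '' {j | j < k})) ∧
    Ideal.span (Set.range f) ≠ ⊤

/-- An `F`-pure regular sequence: a regular sequence such that each successive quotient
`R/(f 0, …, f k)` is `F`-pure. -/
def IsFPureRegSeq (R : Type*) [CommRing R] (p : ℕ) {r : ℕ} (f : Fin r → R) : Prop :=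
  IsRegularSeq R f ∧
    ∀ k : Fin r, IsFPureRing (R ⧸ Ideal.span (f '' {j | j ≤ k})) p

end RegSeq

end FT

namespace FT

lemma irr_fg {K R : Type*} [Field K] [CommRing R] [Algebra K R]
    (𝒜 : ℕ → Submodule K R) (hSG : IsStandardGraded K R 𝒜) : (irrIdeal 𝒜).FG := by
  obtain ⟨S, hS⟩ := hSG.fg1
  refine ⟨S, ?_⟩
  unfold irrIdeal
  rw [← hS]
  apply le_antisymm
  · exact Ideal.span_mono Submodule.subset_span
  · rw [Ideal.span_le]
    intro x hx
    have : Submodule.span K (S : Set R) ≤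
        (Submodule.restrictScalars K (Ideal.span (S : Set R) : Submodule R R)) :=
      Submodule.span_le.2 (fun y hy => Ideal.subset_span hy)
    exact this hx

lemma pow_le_Ie {K R : Type*} [Field K] [CommRing R] [Algebra K R]
    (𝒜 : ℕ → Submodule K R) (hSG : IsStandardGraded K R 𝒜) (p e : ℕ) :
    ∃ n, (irrIdeal 𝒜) ^ n ≤ Ie R p (irrIdeal 𝒜) e := by
  apply Ideal.exists_pow_le_of_le_radical_of_fg _ (irr_fg 𝒜 hSG)
  intro x hx
  refine ⟨p ^ e, ?_⟩
  intro φ hφ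
  have := hφ x 1
  rw [mul_one] at this
  rw [this]
  exact Ideal.mul_mem_right _ _ hx

lemma exists_decomp {K R : Type*} [Field K] [CommRing R] [Algebra K R]
    (𝒜 : ℕ → Submodule K R) (hSG : IsStandardGraded K R 𝒜) (x : R) :
    ∃ c : K, x - algebraMap K R c ∈ irrIdeal 𝒜 := by
  have hx : x ∈ Algebra.adjoin K ((𝒜 1 : Submodule K R) : Set R) := by
    rw [hSG.gen1]; trivial
  induction hx using Algebra.adjoin_induction with
  | mem x hx => exact ⟨0, by rw [map_zero, sub_zero]; exact Ideal.subset_span hx⟩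
  | algebraMap r => exact ⟨r, by simp⟩
  | add x y _ _ hx hy =>
    obtain ⟨a, ha⟩ := hx
    obtain ⟨b, hb⟩ := hy
    refine ⟨a + b, ?_⟩
    have := Ideal.add_mem _ ha hb
    rw [map_add]
    convert this using 1
    ring
  | mul x y _ _ hx hy =>
    obtain ⟨a, ha⟩ := hx
    obtain ⟨b, hb⟩ := hy
    refine ⟨a * b, ?_⟩
    have := Ideal.add_mem _ (Ideal.mul_mem_right y _ ha)
      (Ideal.mul_mem_left _ (algebraMap K R a) hb)
    rw [map_mul]
    convert this using 1
    ring

lemma deg_le_irr {K R : Type*} [Field K] [CommRing R] [Algebra K R]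
    (𝒜 : ℕ → Submodule K R) (hSG : IsStandardGraded K R 𝒜) (d : ℕ) (hd : d ≠ 0)
    (x : R) (hx : x ∈ 𝒜 d) : x ∈ irrIdeal 𝒜 := by
  classical
  let : SetLike.GradedMonoid 𝒜 :=
    { one_mem := by rw [hSG.deg0]; exact Submodule.mem_one.2 ⟨1, map_one _⟩
      mul_mem := fun i j a b ha hb => hSG.mul_le i j (Submodule.mul_mem_mul ha hb) }
  let : DirectSum.Decomposition 𝒜 := hSG.internal.chooseDecomposition
  let : GradedRing 𝒜 := {}
  have hpos : ∀ i, i ≠ 0 → ∀ y ∈ 𝒜 i, y ∈ (HomogeneousIdeal.irrelevant 𝒜).toIdeal := by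
    intro i hi y hy
    change y ∈ HomogeneousIdeal.irrelevant 𝒜
    rw [HomogeneousIdeal.mem_irrelevant_iff, GradedRing.proj_apply,
      DirectSum.decompose_of_mem_ne 𝒜 hy hi]
  have hm : irrIdeal 𝒜 ≤ (HomogeneousIdeal.irrelevant 𝒜).toIdeal :=
    Ideal.span_le.2 (hpos 1 one_ne_zero)
  obtain ⟨c, hc⟩ := exists_decomp 𝒜 hSG x
  have h1 := Ideal.sub_mem _ (hpos d hd x hx) (hm hc)
  rw [sub_sub_cancel] at h1
  have h0 : algebraMap K R c ∈ 𝒜 0 := by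
    rw [hSG.deg0]; exact Submodule.mem_one.2 ⟨c, rfl⟩
  have h2 : algebraMap K R c ∈ HomogeneousIdeal.irrelevant 𝒜 := h1
  rw [HomogeneousIdeal.mem_irrelevant_iff, GradedRing.proj_apply,
    DirectSum.decompose_of_mem_same 𝒜 h0] at h2
  simpa [h2] using hc

lemma le_irr {K R : Type*} [Field K] [CommRing R] [Algebra K R]
    (𝒜 : ℕ → Submodule K R) (hSG : IsStandardGraded K R 𝒜) (J : Ideal R)
    (hJ : IsHomogIdeal 𝒜 J) (hT : J ≠ ⊤) : J ≤ irrIdeal 𝒜 := by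
  obtain ⟨S, hS, rfl⟩ := hJ
  rw [Ideal.span_le]
  intro s hs
  obtain ⟨d, hd⟩ := hS s hs
  by_cases h0 : d = 0
  · subst h0
    rw [hSG.deg0] at hd
    obtain ⟨c, rfl⟩ := Submodule.mem_one.1 hd
    by_cases hc : c = 0
    · simp [hc]
    · exact absurd (Ideal.eq_top_of_isUnit_mem _ (Ideal.subset_span hs)
        ((IsUnit.mk0 c hc).map (algebraMap K R))) hT
  · exact deg_le_irr 𝒜 hSG d h0 s hd

end FT

open FT in
/-- Let `(R, m, K)` be a standard graded `K`-algebra of prime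
characteristic `p` which is `F`-finite and `F`-pure, and let `J ⊆ R` be a homogeneous
ideal.  Then `p·b_J(p^e) ≤ b_J(p^{e+1})` for every `e`, where
`b_J(p^e) = max{r | J^r ⊄ I_e(R)}`. -/
theorem p_mul_bJ_le_bJ_succ
    (K R : Type*) [Field K] [CommRing R] [Algebra K R]
    (𝒜 : ℕ → Submodule K R) (hSG : IsStandardGraded K R 𝒜)
    (p : ℕ) (hp : p.Prime) [CharP R p]
    (hFF : IsFFinite R p) (hFP : IsFPureRing R p)
    (J : Ideal R) (hJ : IsHomogIdeal 𝒜 J) (e : ℕ) :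
    p * bJ R p (irrIdeal 𝒜) J e ≤ bJ R p (irrIdeal 𝒜) J (e + 1) := by
  by_cases hT : J = ⊤
  · have : bJ R p (irrIdeal 𝒜) J e = 0 := by
      unfold bJ
      by_cases h : (⊤ : Ideal R) ≤ Ie R p (irrIdeal 𝒜) e
      · have hs : {r : ℕ | ¬ J ^ r ≤ Ie R p (irrIdeal 𝒜) e} = ∅ := by
          ext r
          simp only [Set.mem_setOf_eq, Set.mem_empty_iff_false, iff_false, not_not]
          exact le_top.trans h
        rw [hs]; simp
      · have hs : {r : ℕ | ¬ J ^ r ≤ Ie R p (irrIdeal 𝒜) e} = Set.univ := by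
          ext r
          simp only [Set.mem_setOf_eq, Set.mem_univ, iff_true]
          rwa [hT, ← Ideal.one_eq_top, one_pow, Ideal.one_eq_top]
        rw [hs]
        exact Nat.sSup_of_not_bddAbove not_bddAbove_univ
    rw [this, mul_zero]
    exact Nat.zero_le _
  have hJm := le_irr 𝒜 hSG J hJ hT
  have hb : ∀ e, BddAbove {r : ℕ | ¬ J ^ r ≤ Ie R p (irrIdeal 𝒜) e} := by
    intro e
    obtain ⟨n, hn⟩ := pow_le_Ie 𝒜 hSG p e
    refine ⟨n, fun r hr => ?_⟩
    by_contra hlt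
    exact hr ((Ideal.pow_le_pow_right (not_le.1 hlt).le).trans
      ((Ideal.pow_right_mono hJm n).trans hn))
  rcases Set.eq_empty_or_nonempty {r : ℕ | ¬ J ^ r ≤ Ie R p (irrIdeal 𝒜) e} with h | h
  · have : bJ R p (irrIdeal 𝒜) J e = 0 := by
      unfold bJ; rw [h]; simp
    rw [this, mul_zero]
    exact Nat.zero_le _
  · have hmem : ¬ J ^ (bJ R p (irrIdeal 𝒜) J e) ≤ Ie R p (irrIdeal 𝒜) e := Nat.sSup_mem h (hb e)
    refine le_csSup (hb (e + 1)) ?_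
    generalize bJ R p (irrIdeal 𝒜) J e = b at hmem
    intro hle
    apply hmem
    intro f hf φ hφ
    obtain ⟨ψ, hψ, hψ1⟩ := hFP
    have hfp : f ^ p ∈ J ^ (p * b) := by
      rw [mul_comm, pow_mul]
      exact Ideal.pow_mem_pow hf p
    have hcomp : φ.comp ψ ∈ frobHoms R p (e + 1) := by
      intro r x
      have h1 := hψ (r ^ p ^ e) x
      rw [pow_one, ← pow_mul, ← pow_succ] at h1
      simp only [AddMonoidHom.coe_comp, Function.comp_apply]
      rw [h1, hφ]
    have h2 := hle hfp _ hcomp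
    have h3 := hψ f 1
    rw [pow_one, mul_one, hψ1, mul_one] at h3
    simpa [h3] using h2
end

section
/- Let (R,m,K) be an F-finite F-pure standard graded K-algebra of characteristic p > 0. Then: (1) each ideal I_e(R) and the splitting prime P(R) := ∩_e I_e(R) are homogeneous ideals; (2) P(R) is a prime ideal; (3) P(R) is the largest homogeneous ideal J of R satisfying φ(J^{1/p^e}) ⊆ J for all φ ∈ Hom_R(R^{1/p^e}, R) and all e; (4) R/P(R) is strongly F-regular; (5) P(R)_m = P(R_m), i.e., the localization of the splitting prime at m equals the splitting prime of the local ring R_m. -/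
/-!
Core definitions: standard graded algebras, Koszul-colimit model of graded local
cohomology nonvanishing, Frobenius splittings, F-purity, F-thresholds.
-/

open Filter

namespace FT

section helpers

variable {R : Type*} [CommRing R]

theorem frob_comp {p e e' : ℕ} {φ ψ : R →+ R} (hφ : φ ∈ frobHoms R p e)
    (hψ : ψ ∈ frobHoms R p e') : ψ.comp φ ∈ frobHoms R p (e' + e) := by
  intro r x
  have : r ^ p ^ (e' + e) = (r ^ p ^ e') ^ p ^ e := by rw [← pow_mul, pow_add]
  simp only [AddMonoidHom.comp_apply]
  rw [this, hφ, hψ]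

theorem frob_premul {p e : ℕ} {φ : R →+ R} (hφ : φ ∈ frobHoms R p e) (a : R) :
    φ.comp (AddMonoidHom.mulLeft a) ∈ frobHoms R p e := by
  intro r x
  simp only [AddMonoidHom.comp_apply, AddMonoidHom.coe_mulLeft]
  rw [mul_left_comm, hφ]

theorem frob_postmul {p e : ℕ} {φ : R →+ R} (hφ : φ ∈ frobHoms R p e) (a : R) :
    (AddMonoidHom.mulLeft a).comp φ ∈ frobHoms R p e := by
  intro r x
  simp only [AddMonoidHom.comp_apply, AddMonoidHom.coe_mulLeft]
  rw [hφ, mul_left_comm]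

theorem frob_id (p : ℕ) : AddMonoidHom.id R ∈ frobHoms R p 0 := by
  intro r x
  simp

theorem mem_Ie {p : ℕ} {m : Ideal R} {e : ℕ} {r : R} :
    r ∈ Ie R p m e ↔ ∀ φ ∈ frobHoms R p e, φ r ∈ m := Iff.rfl

theorem Ie_succ_le {p : ℕ} (hp : p.Prime) (hFP : IsFPureRing R p) (m : Ideal R) (e : ℕ) :
    Ie R p m (e + 1) ≤ Ie R p m e := by
  obtain ⟨π, hπ, h1⟩ := hFP
  intro r hr φ hφ
  have h := mem_Ie.1 ((Ie R p m (e + 1)).mul_mem_left (r ^ (p - 1)) hr) _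
    (frob_comp (e' := e) (e := 1) hπ hφ)
  have h2 : r ^ (p - 1) * r = r ^ p ^ 1 * 1 := by
    rw [← pow_succ, Nat.sub_add_cancel hp.one_le]; simp
  rw [h2, AddMonoidHom.comp_apply, hπ, h1, mul_one] at h
  exact h

theorem Ie_anti {p : ℕ} (hp : p.Prime) (hFP : IsFPureRing R p) (m : Ideal R) :
    Antitone (Ie R p m) := antitone_nat_of_succ_le (Ie_succ_le hp hFP m)

theorem mem_sp {p : ℕ} {m : Ideal R} {r : R} :
    r ∈ splittingPrime R p m ↔ ∀ e, r ∈ Ie R p m e := by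
  simp [splittingPrime, Ideal.mem_iInf]

theorem sp_le (p : ℕ) (m : Ideal R) : splittingPrime R p m ≤ m := by
  intro x hx
  exact mem_Ie.1 (mem_sp.1 hx 0) _ (frob_id p)

theorem sp_compat (p : ℕ) (m : Ideal R) : IsCompatibleIdeal R p (splittingPrime R p m) := by
  intro e φ hφ x hx
  rw [mem_sp]
  intro e' ψ hψ
  exact mem_Ie.1 (mem_sp.1 hx _) _ (frob_comp hφ hψ)

theorem sp_prime {p : ℕ} (hp : p.Prime) (hFP : IsFPureRing R p) (m : Ideal R) (hm : m.IsPrime) :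
    (splittingPrime R p m).IsPrime := by
  refine ⟨fun h => hm.ne_top (top_le_iff.1 (h ▸ sp_le p m)), ?_⟩
  intro a b hab
  by_contra! hcon
  obtain ⟨ha, hb⟩ := hcon
  simp only [mem_sp, mem_Ie, not_forall] at ha hb
  obtain ⟨e, φ, hφ, ha⟩ := ha
  obtain ⟨e', ψ, hψ, hb⟩ := hb
  have hq : p ^ e ≠ 0 := pow_ne_zero _ hp.ne_zero
  have hq' : p ^ e' ≠ 0 := pow_ne_zero _ hp.ne_zero
  -- `a * b ^ q` lies in `P`
  have h1 : b ^ p ^ e * a ∈ splittingPrime R p m := by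
    obtain ⟨k, hk⟩ := Nat.exists_eq_succ_of_ne_zero hq
    rw [hk, pow_succ, mul_assoc, mul_comm b a]
    exact Ideal.mul_mem_left _ _ hab
  have h2 := sp_compat p m e φ hφ _ h1
  rw [hφ] at h2
  have h3 : φ a ^ p ^ e' * b ∈ splittingPrime R p m := by
    obtain ⟨k, hk⟩ := Nat.exists_eq_succ_of_ne_zero hq'
    rw [hk, pow_succ, mul_assoc, mul_comm (φ a) b]
    exact Ideal.mul_mem_left _ _ h2
  have h4 := mem_Ie.1 (mem_sp.1 h3 e') ψ hψ
  rw [hψ] at h4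
  exact (hm.mem_or_mem h4).elim ha hb

/-- Descent of a Frobenius-splitting through a compatible ideal. -/
theorem splits_quot {p e : ℕ} {P : Ideal R} (hP : IsCompatibleIdeal R p P) {f : R}
    (h : FSplitsAt R p e f) : FSplitsAt (R ⧸ P) p e (Ideal.Quotient.mk P f) := by
  obtain ⟨φ, hφ, h1⟩ := h
  refine ⟨QuotientAddGroup.map _ _ φ (fun x hx => hP e φ hφ x hx), ?_, ?_⟩
  · intro r x
    obtain ⟨r, rfl⟩ := Ideal.Quotient.mk_surjective r
    obtain ⟨x, rfl⟩ := Ideal.Quotient.mk_surjective x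
    rw [← map_pow, ← map_mul]
    change Ideal.Quotient.mk P (φ _) = Ideal.Quotient.mk P r * Ideal.Quotient.mk P (φ x)
    rw [hφ, map_mul]
  · change Ideal.Quotient.mk P (φ f) = 1
    rw [h1, map_one]

end helpers

section gradedHelpers

variable {K R : Type*} [Field K] [CommRing R] [Algebra K R]

open DirectSum in
theorem exists_graded_part (𝒜 : ℕ → Submodule K R) [GradedAlgebra 𝒜] (p : ℕ) [ExpChar R p]
    (hp : p.Prime) {e : ℕ} {φ : R →+ R} (hφ : φ ∈ frobHoms R p e) (d : ℕ) :
    ∃ ψ ∈ frobHoms R p e,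
      (∀ k x, x ∈ 𝒜 (d + p ^ e * k) → ψ x = decompose 𝒜 (φ x) k) ∧
      (∀ n x, x ∈ 𝒜 n → (∀ k, n ≠ d + p ^ e * k) → ψ x = 0) := by
  classical
  have hq : 0 < p ^ e := pow_pos hp.pos _
  generalize hqq : p ^ e = q at *
  let pr : ℕ → R →+ R := fun k => GradedRing.proj 𝒜 k
  have hpr : ∀ k x, pr k x = decompose 𝒜 x k := fun k x => rfl
  let g : ∀ n : ℕ, 𝒜 n →+ R := fun n =>
    if ∃ k, n = d + q * k then
      ((pr ((n - d) / q)).comp φ).comp (𝒜 n).subtype.toAddMonoidHom else 0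
  let ψ : R →+ R := (DirectSum.toAddMonoid g).comp (decomposeAddEquiv 𝒜).toAddMonoidHom
  have hψ : ∀ n x (hx : x ∈ 𝒜 n), ψ x = g n ⟨x, hx⟩ := by
    intro n x hx
    change DirectSum.toAddMonoid g (decompose 𝒜 x) = _
    rw [decompose_of_mem 𝒜 hx, DirectSum.toAddMonoid_of]
  have h1 : ∀ k x, x ∈ 𝒜 (d + q * k) → ψ x = decompose 𝒜 (φ x) k := by
    intro k x hx
    rw [hψ _ x hx]
    have : (d + q * k - d) / q = k := by
      rw [Nat.add_sub_cancel_left, Nat.mul_div_cancel_left _ hq]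
    simp only [g]
    rw [if_pos ⟨k, rfl⟩, this]
    rfl
  have h2 : ∀ n x, x ∈ 𝒜 n → (∀ k, n ≠ d + q * k) → ψ x = 0 := by
    intro n x hx hn
    rw [hψ _ x hx]
    simp only [g]
    rw [if_neg (by push Not; exact hn)]
    rfl
  refine ⟨ψ, ?_, h1, h2⟩
  intro r x
  rw [hqq]
  have hφ' : ∀ r x, φ (r ^ q * x) = r * φ x := by
    intro r x; rw [← hqq]; exact hφ r x
  induction r using DirectSum.Decomposition.inductionOn 𝒜 with
  | zero => simp [hq.ne']
  | add r s hr hs =>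
    have : (r + s) ^ q = r ^ q + s ^ q := by rw [← hqq]; exact add_pow_expChar_pow ..
    rw [this, add_mul, map_add, hr, hs, add_mul]
  | @homogeneous a r =>
    induction x using DirectSum.Decomposition.inductionOn 𝒜 with
    | zero => simp
    | add x y hx hy => rw [mul_add, map_add, hx, hy, map_add, mul_add]
    | @homogeneous n x =>
      have hmem : (r : R) ^ q * (x : R) ∈ 𝒜 (q * a + n) := by
        have := SetLike.pow_mem_graded q r.2
        exact SetLike.mul_mem_graded this x.2
      by_cases hn : ∃ k, n = d + q * k
      · obtain ⟨k, rfl⟩ := hn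
        rw [h1 k _ x.2, h1 (k + a) _ (by convert hmem using 2; ring), hφ',
          DirectSum.coe_decompose_mul_of_left_mem_of_le 𝒜 r.2 (Nat.le_add_left a k),
          Nat.add_sub_cancel]
      · push Not at hn
        rw [h2 n _ x.2 hn, mul_zero]
        by_cases hn' : ∃ k, q * a + n = d + q * k
        · obtain ⟨k, hk⟩ := hn'
          rw [h1 k _ (hk ▸ hmem), hφ', DirectSum.coe_decompose_mul_of_left_mem_of_not_le 𝒜 r.2]
          intro hak
          obtain ⟨c, rfl⟩ := Nat.exists_eq_add_of_le hak
          exact hn c (by rw [mul_add] at hk; omega)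
        · push Not at hn'
          exact h2 _ _ hmem hn'

open DirectSum in
theorem mem_irr_iff (𝒜 : ℕ → Submodule K R) [GradedAlgebra 𝒜]
    (hm : (irrIdeal 𝒜).IsMaximal) (x : R) :
    x ∈ irrIdeal 𝒜 ↔ (decompose 𝒜 x 0 : R) = 0 := by
  have : Nontrivial R := Ideal.Quotient.nontrivial_iff.2 hm.ne_top |>.1.elim
    fun a ⟨b, h⟩ => by
      obtain ⟨a, rfl⟩ := Ideal.Quotient.mk_surjective a
      obtain ⟨b, rfl⟩ := Ideal.Quotient.mk_surjective b
      exact ⟨a, b, fun hab => h (by rw [hab])⟩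
  have h : irrIdeal 𝒜 = (HomogeneousIdeal.irrelevant 𝒜).toIdeal := by
    refine hm.eq_of_le ?_ ?_
    · intro h
      have h1 : (1 : R) ∈ (HomogeneousIdeal.irrelevant 𝒜).toIdeal := by rw [h]; trivial
      have h2 : (decompose 𝒜 (1 : R) 0 : R) = 0 := h1
      rw [decompose_of_mem_same 𝒜 (SetLike.GradedOne.one_mem)] at h2
      exact one_ne_zero h2
    · refine Ideal.span_le.2 fun x hx => ?_
      exact HomogeneousIdeal.mem_irrelevant_of_mem 𝒜 Nat.one_pos hx
  rw [h]
  rfl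

theorem isHomog_iff (𝒜 : ℕ → Submodule K R) [GradedAlgebra 𝒜] (J : Ideal R) :
    IsHomogIdeal 𝒜 J ↔ J.IsHomogeneous 𝒜 := by
  constructor
  · rintro ⟨S, hS, rfl⟩
    exact Ideal.homogeneous_span 𝒜 S hS
  · intro h
    obtain ⟨S, hS⟩ := (Ideal.IsHomogeneous.iff_exists 𝒜 J).1 h
    refine ⟨_, ?_, hS⟩
    rintro _ ⟨s, -, rfl⟩
    exact s.2

open DirectSum in
theorem Ie_homog (𝒜 : ℕ → Submodule K R) [GradedAlgebra 𝒜] (p : ℕ) [ExpChar R p]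
    (hp : p.Prime) (hm : (irrIdeal 𝒜).IsMaximal) (e : ℕ) :
    (Ie R p (irrIdeal 𝒜) e).IsHomogeneous 𝒜 := by
  intro d r hr φ hφ
  obtain ⟨ψ, hψ, h1, h2⟩ := exists_graded_part 𝒜 p hp hφ d
  have key : ∀ x : R, (decompose 𝒜 (ψ x) 0 : R) = decompose 𝒜 (φ (decompose 𝒜 x d)) 0 := by
    intro x
    induction x using DirectSum.Decomposition.inductionOn 𝒜 with
    | zero => simp
    | add x y hx hy => simp [hx, hy]
    | @homogeneous n x =>
      by_cases hn : n = d
      · subst hn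
        rw [h1 0 x (by simp), decompose_of_mem_same 𝒜 (SetLike.coe_mem _),
          decompose_of_mem_same 𝒜 x.2]
      · rw [decompose_of_mem_ne 𝒜 x.2 hn, map_zero]
        by_cases hn' : ∃ k, n = d + p ^ e * k
        · obtain ⟨k, rfl⟩ := hn'
          rw [h1 k x x.2, decompose_of_mem_ne 𝒜 (SetLike.coe_mem _)]
          · simp
          · rintro rfl; simp at hn
        · push Not at hn'
          rw [h2 n x x.2 hn']
  rw [mem_irr_iff 𝒜 hm, ← key, ← mem_irr_iff 𝒜 hm]
  exact hr ψ hψ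

open DirectSum in
theorem exists_split (𝒜 : ℕ → Submodule K R) [GradedAlgebra 𝒜] (p : ℕ) [ExpChar R p]
    (hp : p.Prime) (hm : (irrIdeal 𝒜).IsMaximal) (h0 : 𝒜 0 = 1) (hFP : IsFPureRing R p)
    (f : R) (hf : f ∉ splittingPrime R p (irrIdeal 𝒜)) : ∃ e, FSplitsAt R p e f := by
  classical
  have hd : ∃ d, (decompose 𝒜 f d : R) ∉ splittingPrime R p (irrIdeal 𝒜) := by
    by_contra! hcon
    apply hf
    rw [← sum_support_decompose 𝒜 f]
    exact Ideal.sum_mem _ fun i _ => hcon i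
  obtain ⟨d, hd⟩ := hd
  simp only [mem_sp, not_forall] at hd
  obtain ⟨e0, hd⟩ := hd
  obtain ⟨N, hN⟩ := (decompose 𝒜 f).support.bddAbove
  obtain ⟨e, he0, heN⟩ : ∃ e, e0 ≤ e ∧ N < p ^ e :=
    ⟨max e0 N, le_max_left _ _,
      lt_of_lt_of_le (Nat.lt_pow_self hp.one_lt) (Nat.pow_le_pow_right hp.pos (le_max_right _ _))⟩
  have hd' : (decompose 𝒜 f d : R) ∉ Ie R p (irrIdeal 𝒜) e :=
    fun h => hd (Ie_anti hp hFP _ he0 h)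
  simp only [mem_Ie, not_forall] at hd'
  obtain ⟨φ, hφ, hφd⟩ := hd'
  rw [mem_irr_iff 𝒜 hm] at hφd
  obtain ⟨ψ, hψ, h1, h2⟩ := exists_graded_part 𝒜 p hp hφ d
  have hψf : ψ f = decompose 𝒜 (φ (decompose 𝒜 f d)) 0 := by
    conv_lhs => rw [← sum_support_decompose 𝒜 f]
    rw [map_sum, Finset.sum_eq_single d]
    · exact h1 0 _ (by simp)
    · intro n hn hnd
      refine h2 n _ (SetLike.coe_mem _) ?_
      rintro k rfl
      have := hN hn
      rcases k with _ | k
      · simp at hnd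
      · rw [mul_add] at this
        omega
    · intro hn
      rw [DFinsupp.notMem_support_iff.1 hn]
      simp
  have hc : (decompose 𝒜 (φ (decompose 𝒜 f d)) 0 : R) ∈ (1 : Submodule K R) := by
    rw [← h0]; exact SetLike.coe_mem _
  obtain ⟨c, hc⟩ := Submodule.mem_one.1 hc
  have hc0 : c ≠ 0 := by
    rintro rfl
    exact hφd (by rw [← hc, map_zero])
  refine ⟨e, (AddMonoidHom.mulLeft (algebraMap K R c⁻¹)).comp ψ, frob_postmul hψ _, ?_⟩
  simp only [AddMonoidHom.comp_apply, AddMonoidHom.coe_mulLeft]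
  rw [hψf, ← hc, ← map_mul, inv_mul_cancel₀ hc0, map_one]

open DirectSum in
theorem homog_le_irr (𝒜 : ℕ → Submodule K R) [GradedAlgebra 𝒜]
    (hm : (irrIdeal 𝒜).IsMaximal) (h0 : 𝒜 0 = 1) (J : Ideal R) (hJ : J ≠ ⊤)
    (hJh : J.IsHomogeneous 𝒜) : J ≤ irrIdeal 𝒜 := by
  intro x hx
  rw [mem_irr_iff 𝒜 hm]
  have h1 := hJh 0 hx
  have hc : (decompose 𝒜 x 0 : R) ∈ (1 : Submodule K R) := by
    rw [← h0]; exact SetLike.coe_mem _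
  obtain ⟨c, hc⟩ := Submodule.mem_one.1 hc
  rw [← hc] at h1 ⊢
  by_contra hne
  have hc0 : c ≠ 0 := by
    rintro rfl
    exact hne (map_zero _)
  apply hJ
  rw [Ideal.eq_top_iff_one]
  have := J.mul_mem_left (algebraMap K R c⁻¹) h1
  rwa [← map_mul, inv_mul_cancel₀ hc0, map_one] at this

end gradedHelpers

section locHelpers

/-- `A` viewed as an `R`-module through a ring homomorphism `R → A`. -/
def FM {R A : Type*} [CommRing R] [CommRing A] (_f : R →+* A) : Type _ := A

instance {R A : Type*} [CommRing R] [CommRing A] (f : R →+* A) : AddCommGroup (FM f) :=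
  inferInstanceAs (AddCommGroup A)

instance {R A : Type*} [CommRing R] [CommRing A] (f : R →+* A) : Module R (FM f) :=
  Module.compHom A f

theorem FM_smul {R A : Type*} [CommRing R] [CommRing A] (f : R →+* A) (r : R) (x : FM f) :
    r • x = (f r * (show A from x) : A) := rfl

variable {R : Type*} [CommRing R]

theorem finite_iter (p : ℕ) [ExpChar R p] (hFF : IsFFinite R p) (e : ℕ) :
    (iterateFrobenius R p e).Finite := by
  have h1 : (frobenius R p).Finite := by
    obtain ⟨s, hs⟩ := hFF
    have key : Module.Finite R (FM (frobenius R p)) := by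
     refine ⟨⟨(s : Finset R), ?_⟩⟩
     rw [eq_top_iff]
     intro x _
     obtain ⟨c, hc⟩ := hs x
     have hx : x = ∑ y ∈ s, c y • (show FM (frobenius R p) from y) := hc
     rw [hx]
     exact Submodule.sum_mem _ fun y hy => Submodule.smul_mem _ _ (Submodule.subset_span hy)
    exact key
  induction e with
  | zero =>
    rw [iterateFrobenius_zero]
    exact RingHom.Finite.id R
  | succ e ih =>
    rw [iterateFrobenius_add, iterateFrobenius_one]
    exact ih.comp h1

theorem FM_finite (p : ℕ) [ExpChar R p] (hFF : IsFFinite R p) (e : ℕ) :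
    Module.Finite R (FM (iterateFrobenius R p e)) := finite_iter p hFF e

variable (A : Type*) [CommRing A] [Algebra R A]

/-- localization on Frobenius twists -/
def FMloc (p : ℕ) [ExpChar R p] (e : ℕ) :
    FM (iterateFrobenius R p e) →ₗ[R] FM ((algebraMap R A).comp (iterateFrobenius R p e)) where
  toFun x := algebraMap R A x
  map_add' x y := map_add (algebraMap R A) _ _
  map_smul' r x := map_mul (algebraMap R A) _ _

theorem FMloc_isLoc (p : ℕ) [ExpChar R p] (hp : p.Prime) (e : ℕ) (S : Submonoid R)
    [IsLocalization S A] : IsLocalizedModule S (FMloc A p e) where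
  map_units s := by
    have hu : IsUnit ((algebraMap R A) (s : R) ^ p ^ e) := (IsLocalization.map_units A s).pow _
    rw [Module.End.isUnit_iff]
    have : ((algebraMap R (Module.End R (FM ((algebraMap R A).comp (iterateFrobenius R p e)))) s :
        _ → _)) = fun x : A => (algebraMap R A) (s : R) ^ p ^ e * x := by
      funext x
      change (algebraMap R A) ((s : R) ^ p ^ e) * _ = _
      rw [map_pow]
      rfl
    rw [this]
    obtain ⟨u, hu⟩ := hu
    rw [← hu]
    exact (Units.mulLeft u).bijective
  surj y := by
    obtain ⟨⟨x, s⟩, h⟩ := IsLocalization.surj (M := S) (S := A) y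
    obtain ⟨k, hk⟩ := Nat.exists_eq_succ_of_ne_zero (pow_ne_zero e hp.ne_zero)
    refine ⟨(((s : R) ^ k * x : R), s), ?_⟩
    change (algebraMap R A) ((s : R) ^ p ^ e) * _ = algebraMap R A ((s : R) ^ k * x)
    rw [hk, map_mul, ← h, pow_succ, map_mul]
    exact (mul_assoc _ _ _).trans (congrArg _ (mul_comm _ _))
  exists_of_eq {x y} h := by
    obtain ⟨c, hc⟩ := (IsLocalization.eq_iff_exists S A).1 h
    obtain ⟨k, hk⟩ := Nat.exists_eq_succ_of_ne_zero (pow_ne_zero e hp.ne_zero)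
    refine ⟨c, ?_⟩
    change ((c : R) ^ p ^ e) * (show R from x) = ((c : R) ^ p ^ e) * (show R from y)
    rw [hk, pow_succ, mul_assoc, mul_assoc]
    exact congrArg _ hc

theorem sp_loc [IsNoetherianRing R] (p : ℕ) [ExpChar R p] (hp : p.Prime) (hFF : IsFFinite R p)
    (m : Ideal R) [hm : m.IsPrime] [IsLocalization.AtPrime A m] :
    Ideal.map (algebraMap R A) (splittingPrime R p m) =
      splittingPrime A p (Ideal.map (algebraMap R A) m) := by
  have hcm : ∀ x, algebraMap R A x ∈ Ideal.map (algebraMap R A) m → x ∈ m := by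
    intro x hx
    rw [IsLocalization.algebraMap_mem_map_algebraMap_iff m.primeCompl] at hx
    obtain ⟨s, hs, h⟩ := hx
    exact (hm.mem_or_mem h).resolve_left hs
  apply le_antisymm
  · rw [Ideal.map_le_iff_le_comap]
    intro x hx
    rw [Ideal.mem_comap, mem_sp]
    intro e φ' hφ'
    have := FM_finite p hFF e
    have : Module.FinitePresentation R (FM (iterateFrobenius R p e)) :=
      Module.finitePresentation_of_finite R _
    let g : FM (iterateFrobenius R p e) →ₗ[R] A :=
      { toFun := fun x => φ' (algebraMap R A x)
        map_add' := fun x y => by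
          have : ∀ x y : R, φ' (algebraMap R A (x + y)) =
              φ' (algebraMap R A x) + φ' (algebraMap R A y) := by intro x y; simp
          exact this x y
        map_smul' := fun r x => by
          have : φ' (algebraMap R A (r ^ p ^ e * (show R from x))) =
              r • φ' (algebraMap R A (show R from x)) := by
            rw [map_mul, map_pow, hφ', Algebra.smul_def]
          exact this }
    obtain ⟨h, s, hs⟩ := Module.FinitePresentation.exists_lift_of_isLocalizedModule
      m.primeCompl (Algebra.linearMap R A) g
    let φ : R →+ R := h.toAddMonoidHom
    have hφ : φ ∈ frobHoms R p e := fun r x => h.map_smul r x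
    have h1 : φ x ∈ m := mem_Ie.1 (mem_sp.1 hx e) φ hφ
    have h2 : algebraMap R A (φ x) = algebraMap R A (s : R) * φ' (algebraMap R A x) := by
      have := LinearMap.congr_fun hs x
      rw [← Algebra.smul_def]
      exact this
    have h3 := Ideal.mem_map_of_mem (algebraMap R A) h1
    rw [h2] at h3
    exact (Ideal.unit_mul_mem_iff_mem _ (IsLocalization.map_units A s)).1 h3
  · intro y hy
    obtain ⟨⟨x, s⟩, h⟩ := IsLocalization.surj (M := m.primeCompl) (S := A) y
    have hx : algebraMap R A x ∈ splittingPrime A p (Ideal.map (algebraMap R A) m) := by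
      rw [← h]; exact Ideal.mul_mem_right _ _ hy
    suffices hxP : x ∈ splittingPrime R p m by
      have h3 := Ideal.mem_map_of_mem (algebraMap R A) hxP
      rw [← h] at h3
      exact (Ideal.mul_unit_mem_iff_mem _ (IsLocalization.map_units A s)).1 h3
    rw [mem_sp]
    intro e φ hφ
    apply hcm
    have hloc := FMloc_isLoc A p hp e m.primeCompl
    let g : FM (iterateFrobenius R p e) →ₗ[R] A :=
      { toFun := fun x => algebraMap R A (φ x)
        map_add' := fun x y => by
          have : ∀ x y : R, algebraMap R A (φ (x + y)) =
              algebraMap R A (φ x) + algebraMap R A (φ y) := by intro x y; simp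
          exact this x y
        map_smul' := fun r x => by
          have : algebraMap R A (φ (r ^ p ^ e * (show R from x))) =
              r • algebraMap R A (φ (show R from x)) := by
            rw [hφ, map_mul, Algebra.smul_def]
          exact this }
    let G := IsLocalizedModule.lift m.primeCompl (FMloc A p e) g
      (fun s => IsLocalizedModule.map_units (Algebra.linearMap R A) s)
    have hG : ∀ x : R, G (FMloc A p e x) = algebraMap R A (φ x) := fun x =>
      IsLocalizedModule.lift_apply ..
    let φ' : A →+ A := G.toAddMonoidHom
    have hlin : ∀ (r : R) (x : A), φ' (algebraMap R A r ^ p ^ e * x) = algebraMap R A r * φ' x := by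
      intro r x
      have := G.map_smul r x
      rw [Algebra.smul_def] at this
      rw [← map_pow]
      exact this
    have hφ' : φ' ∈ frobHoms A p e := by
      intro r x
      obtain ⟨⟨a, s⟩, has⟩ := IsLocalization.surj (M := m.primeCompl) (S := A) r
      apply (IsLocalization.map_units A s).mul_left_cancel
      rw [← hlin, ← mul_assoc, ← mul_pow, mul_comm (algebraMap R A s) r, has, hlin, ← mul_assoc,
        mul_comm (algebraMap R A s) r, has]
    have := mem_Ie.1 (mem_sp.1 hx e) φ' hφ'
    have h4 : φ' (algebraMap R A x) = algebraMap R A (φ x) := hG x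
    rwa [h4] at this

end locHelpers

end FT

open FT in
/-- Let `(R, m, K)` be an `F`-finite `F`-pure standard graded
`K`-algebra of prime characteristic `p`.  Then: (1) each `I_e(R)` and the splitting
prime `𝒫(R) = ⋂ₑ I_e(R)` are homogeneous ideals; (2) `𝒫(R)` is prime; (3) `𝒫(R)` is
the largest (proper) homogeneous ideal `J` with `φ(J^{1/p^e}) ⊆ J` for all
`φ ∈ Hom_R(R^{1/p^e}, R)` and all `e`; (4) `R/𝒫(R)` is strongly `F`-regular;
(5) `𝒫(R)ₘ = 𝒫(Rₘ)`. -/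
theorem splittingPrime_properties
    (K R : Type*) [Field K] [CommRing R] [Algebra K R]
    (𝒜 : ℕ → Submodule K R) (hSG : IsStandardGraded K R 𝒜)
    (p : ℕ) (hp : p.Prime) [CharP R p]
    (hFF : IsFFinite R p) (hFP : IsFPureRing R p)
    (hm : (irrIdeal 𝒜).IsMaximal) :
    (∀ e : ℕ, IsHomogIdeal 𝒜 (Ie R p (irrIdeal 𝒜) e)) ∧
    IsHomogIdeal 𝒜 (splittingPrime R p (irrIdeal 𝒜)) ∧
    (splittingPrime R p (irrIdeal 𝒜)).IsPrime ∧
    IsCompatibleIdeal R p (splittingPrime R p (irrIdeal 𝒜)) ∧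
    (∀ J : Ideal R, J ≠ ⊤ → IsHomogIdeal 𝒜 J → IsCompatibleIdeal R p J →
      J ≤ splittingPrime R p (irrIdeal 𝒜)) ∧
    IsStronglyFRegular (R ⧸ splittingPrime R p (irrIdeal 𝒜)) p ∧
    (haveI : (irrIdeal 𝒜).IsPrime := hm.isPrime
     Ideal.map (algebraMap R (Localization.AtPrime (irrIdeal 𝒜)))
        (splittingPrime R p (irrIdeal 𝒜)) =
      splittingPrime (Localization.AtPrime (irrIdeal 𝒜)) p
        (Ideal.map (algebraMap R (Localization.AtPrime (irrIdeal 𝒜))) (irrIdeal 𝒜))) := by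
  haveI : Fact p.Prime := ⟨hp⟩
  haveI : ExpChar R p := ExpChar.prime hp
  letI : DirectSum.Decomposition 𝒜 := hSG.internal.chooseDecomposition
  letI : SetLike.GradedMonoid 𝒜 :=
    { one_mem := by rw [hSG.deg0]; exact Submodule.one_le.1 le_rfl
      mul_mem := fun {i j a b} ha hb => hSG.mul_le i j (Submodule.mul_mem_mul ha hb) }
  letI : GradedAlgebra 𝒜 := { }
  haveI : Algebra.FiniteType K R := by
    obtain ⟨s, hs⟩ := hSG.fg1
    refine ⟨⟨s, ?_⟩⟩
    rw [eq_top_iff, ← hSG.gen1]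
    refine Algebra.adjoin_le ?_
    rw [← hs]
    exact Algebra.span_le_adjoin K _
  haveI : IsNoetherianRing R := Algebra.FiniteType.isNoetherianRing K R
  have hI := Ie_homog 𝒜 p hp hm
  refine ⟨fun e => (isHomog_iff 𝒜 _).2 (hI e), (isHomog_iff 𝒜 _).2 (Ideal.IsHomogeneous.iInf hI),
    sp_prime hp hFP _ hm.isPrime, sp_compat p _, ?_, ?_, ?_⟩
  · intro J hJ hJh hJc x hx
    rw [mem_sp]
    intro e φ hφ
    exact homog_le_irr 𝒜 hm hSG.deg0 J hJ ((isHomog_iff 𝒜 J).1 hJh) (hJc e φ hφ x hx)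
  · intro f hf
    obtain ⟨f, rfl⟩ := Ideal.Quotient.mk_surjective f
    have hf' : f ∉ splittingPrime R p (irrIdeal 𝒜) :=
      fun h => hf (Ideal.Quotient.eq_zero_iff_mem.2 h)
    obtain ⟨e, he⟩ := exists_split 𝒜 p hp hm hSG.deg0 hFP f hf'
    exact ⟨e, splits_quot (sp_compat p _) he⟩
  · haveI := hm.isPrime
    exact sp_loc _ p hp hFF _
end

section
/- Let (R,m,K) be a standard graded K-algebra of characteristic p > 0 which is F-finite and F-pure. If a_i(R) = 0 for some i, then sdim(R) = 0; that is, the splitting prime P(R) equals m. -/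
/-!
Core definitions: standard graded algebras, Koszul-colimit model of graded local
cohomology nonvanishing, Frobenius splittings, F-purity, F-thresholds.
-/

open Filter

namespace FT

lemma aux_kd_apply {R : Type*} [CommRing R] {n : ℕ} (f : Fin n → R) (k : ℕ) (ω : KC n R k)
    (s : {s : Finset (Fin n) // s.card = k + 1}) :
    kd R f k ω s = ∑ i ∈ s.1.attach,
    ((-1 : ℤ) ^ (s.1.filter (fun j => j < i.1)).card) •
      (f i.1 * ω ⟨s.1.erase i.1, by simp [Finset.card_erase_of_mem i.2, s.2]⟩) := rfl

lemma aux_ktr_apply {R : Type*} [CommRing R] {n : ℕ} (f : Fin n → R) (c k : ℕ) (ω : KC n R k)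
    (s : {s : Finset (Fin n) // s.card = k}) :
    ktr R f c k ω s = (∏ i ∈ s.1, f i) ^ c * ω s := rfl

lemma aux_ktr_ktr {R : Type*} [CommRing R] {n : ℕ} (f : Fin n → R) (c c' k : ℕ) (ω : KC n R k) :
    ktr R f c' k (ktr R f c k ω) = ktr R f (c + c') k ω := by
  funext s
  simp only [aux_ktr_apply]
  ring

lemma aux_B_tr {R : Type*} [CommRing R] {n : ℕ} (x : Fin n → R) (a c : ℕ) :
    ∀ (i : ℕ) (ω : KC n R i), ω ∈ koszulB R (fun l => x l ^ a) i →
      ktr R x c i ω ∈ koszulB R (fun l => x l ^ (a + c)) i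
  | 0, ω, h => by
    have h0 : ω = 0 := h
    rw [h0, map_zero]
    exact Submodule.zero_mem _
  | (i + 1), ω, h => by
    obtain ⟨η, rfl⟩ := h
    refine ⟨ktr R x c i η, ?_⟩
    funext s
    simp only [aux_kd_apply, aux_ktr_apply, Finset.mul_sum]
    refine Finset.sum_congr rfl fun j _ => ?_
    rw [mul_smul_comm, ← Finset.mul_prod_erase s.1 x j.2, mul_pow, pow_add]
    congr 1
    ring

lemma aux_B_tr_le {R : Type*} [CommRing R] {n : ℕ} (x : Fin n → R) (t c c' i : ℕ) (h : c ≤ c')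
    (ω : KC n R i) (hω : ktr R x c i ω ∈ koszulB R (fun l => x l ^ (t + c)) i) :
    ktr R x c' i ω ∈ koszulB R (fun l => x l ^ (t + c')) i := by
  obtain ⟨d, rfl⟩ := Nat.exists_eq_add_of_le h
  have := aux_B_tr x (t + c) d i _ hω
  rw [aux_ktr_ktr] at this
  simpa [add_assoc] using this

/-- The ideal of elements killing a class in the limit. -/
def annLim {R : Type*} [CommRing R] {n : ℕ} (x : Fin n → R) (t i : ℕ) (ω : KC n R i) :
    Ideal R where
  carrier := {r | ∃ c, ktr R x c i (r • ω) ∈ koszulB R (fun l => x l ^ (t + c)) i}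
  zero_mem' := ⟨0, by rw [zero_smul, map_zero]; exact Submodule.zero_mem _⟩
  add_mem' := by
    rintro a b ⟨c, hc⟩ ⟨d, hd⟩
    refine ⟨max c d, ?_⟩
    rw [add_smul, map_add]
    exact Submodule.add_mem _ (aux_B_tr_le x t c _ i (le_max_left _ _) _ hc)
      (aux_B_tr_le x t d _ i (le_max_right _ _) _ hd)
  smul_mem' := by
    rintro r a ⟨c, hc⟩
    refine ⟨c, ?_⟩
    rw [smul_assoc, map_smul]
    exact Submodule.smul_mem _ r hc

lemma aux_frob_B {R : Type*} [CommRing R] {n : ℕ} (p e : ℕ) (φ : R →+ R)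
    (hφ : φ ∈ frobHoms R p e) (x : Fin n → R) (a : ℕ) :
    ∀ (i : ℕ) (ω : KC n R i), ω ∈ koszulB R (fun l => x l ^ (p ^ e * a)) i →
      (fun s => φ (ω s)) ∈ koszulB R (fun l => x l ^ a) i
  | 0, ω, h => by
    have h0 : ω = 0 := h
    subst h0
    show _ = _
    funext s
    simp
  | (i + 1), ω, h => by
    obtain ⟨η, rfl⟩ := h
    refine ⟨fun s => φ (η s), ?_⟩
    funext s
    simp only [aux_kd_apply, map_sum, map_zsmul]
    refine Finset.sum_congr rfl fun j _ => ?_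
    rw [mul_comm (p ^ e) a, pow_mul, hφ]

lemma aux_frob_Z {R : Type*} [CommRing R] {n : ℕ} (p e : ℕ) [ExpChar R p]
    (x : Fin n → R) (a i : ℕ) (y : R) (ω : KC n R i)
    (h : ω ∈ koszulZ R (fun l => x l ^ a) i) :
    (fun s => y * ω s ^ p ^ e : KC n R i) ∈ koszulZ R (fun l => x l ^ (p ^ e * a)) i := by
  have h0 : kd R (fun l => x l ^ a) i ω = 0 := h
  show kd R _ i _ = 0
  funext s
  have h1 := congrArg (iterateFrobenius R p e) (congrFun h0 s)
  simp only [aux_kd_apply, map_sum, map_zsmul, map_mul, iterateFrobenius_def, Pi.zero_apply,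
    map_zero] at h1
  have h2 := congrArg (fun z => y * z) h1
  simp only [Finset.mul_sum] at h2
  rw [aux_kd_apply]
  refine Eq.trans (Finset.sum_congr rfl fun j _ => ?_) (h2.trans ?_)
  · rw [mul_smul_comm]
    congr 1
    ring
  · simp

lemma aux_pow_mem {K R : Type*} [Field K] [CommRing R] [Algebra K R]
    {𝒜 : ℕ → Submodule K R} (hSG : IsStandardGraded K R 𝒜) {d : ℕ} {r : R} (hr : r ∈ 𝒜 d) :
    ∀ q : ℕ, r ^ q ∈ 𝒜 (q * d)
  | 0 => by
    rw [pow_zero, zero_mul, hSG.deg0]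
    exact Submodule.one_le.mp le_rfl
  | q + 1 => by
    rw [pow_succ, Nat.succ_mul]
    exact hSG.mul_le _ _ (Submodule.mul_mem_mul (aux_pow_mem hSG hr q) hr)

lemma aux_decomp {K R : Type*} [Field K] [CommRing R] [Algebra K R]
    {𝒜 : ℕ → Submodule K R} (hSG : IsStandardGraded K R 𝒜) (r : R) :
    ∃ c : K, r - algebraMap K R c ∈ irrIdeal 𝒜 := by
  have hr : r ∈ Algebra.adjoin K ((𝒜 1 : Submodule K R) : Set R) := by
    rw [hSG.gen1]; trivial
  induction hr using Algebra.adjoin_induction with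
  | mem y hy => exact ⟨0, by
    rw [map_zero, sub_zero]
    exact Ideal.subset_span hy⟩
  | algebraMap c => exact ⟨c, by simp⟩
  | add a b _ _ ha hb =>
    obtain ⟨c, hc⟩ := ha
    obtain ⟨d, hd⟩ := hb
    refine ⟨c + d, ?_⟩
    have := Ideal.add_mem _ hc hd
    rw [map_add]
    convert this using 1
    ring
  | mul a b _ _ ha hb =>
    obtain ⟨c, hc⟩ := ha
    obtain ⟨d, hd⟩ := hb
    refine ⟨c * d, ?_⟩
    have := Ideal.add_mem _ (Ideal.mul_mem_left _ b hc)
      (Ideal.mul_mem_left _ (algebraMap K R c) hd)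
    rw [map_mul]
    convert this using 1
    ring

end FT

open FT in
/-- Let `(R, m, K)` be a standard graded `K`-algebra of prime
characteristic `p` which is `F`-finite and `F`-pure.  If `a_i(R) = 0` for some `i`,
then `sdim(R) = 0`; that is, the splitting prime `𝒫(R) = ⋂ₑ I_e(R)` equals `m`. -/
theorem splittingPrime_eq_irrIdeal_of_aInv_eq_zero
    (K R : Type*) [Field K] [CommRing R] [Algebra K R]
    (𝒜 : ℕ → Submodule K R) (hSG : IsStandardGraded K R 𝒜)
    (p : ℕ) (hp : p.Prime) [CharP R p]
    (hFF : IsFFinite R p) (hFP : IsFPureRing R p)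
    (i : ℕ) (ha : IsGreatest {j : ℤ | lcNonzero K R 𝒜 i j} 0) :
    splittingPrime R p (irrIdeal 𝒜) = irrIdeal 𝒜 := by
  haveI : Fact p.Prime := ⟨hp⟩
  haveI : ExpChar R p := ExpChar.prime hp
  obtain ⟨⟨n, x, hx, hspan, t, ω, ht, hZ, hdeg, hB⟩, hub⟩ := ha
  have hvan : ¬ lcNonzero K R 𝒜 i 1 := fun h => by
    have : (1 : ℤ) ≤ 0 := hub h
    omega
  have hdeg' : ∀ s, ω s ∈ 𝒜 (t * i) := fun s => by
    have h := hdeg s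
    have e1 : (0 : ℤ) + (t : ℤ) * (i : ℤ) = ((t * i : ℕ) : ℤ) := by push_cast; ring
    rw [e1, zdeg, if_pos (Int.natCast_nonneg _), Int.toNat_natCast] at h
    exact h
  -- key vanishing
  have key : ∀ (e : ℕ) (y : R), y ∈ 𝒜 1 → ∃ c,
      ktr R x c i (fun s => y * ω s ^ p ^ e) ∈ koszulB R (fun l => x l ^ (p ^ e * t + c)) i := by
    intro e y hy
    by_contra hcon
    push Not at hcon
    refine hvan ⟨n, x, hx, hspan, p ^ e * t, _, ?_, aux_frob_Z p e x t i y ω hZ, ?_, hcon⟩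
    · exact Nat.mul_pos (pow_pos hp.pos e) ht
    · intro s
      have e1 : (1 : ℤ) + ((p ^ e * t : ℕ) : ℤ) * (i : ℤ) = ((1 + p ^ e * (t * i) : ℕ) : ℤ) := by
        push_cast; ring
      rw [e1, zdeg, if_pos (Int.natCast_nonneg _), Int.toNat_natCast]
      exact hSG.mul_le _ _ (Submodule.mul_mem_mul hy (aux_pow_mem hSG (hdeg' s) _))
  have hm : irrIdeal 𝒜 ≤ annLim x t i ω := by
    refine Ideal.span_le.mpr fun y hy => ?_
    obtain ⟨c, hc⟩ := key 0 y hy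
    refine ⟨c, ?_⟩
    simp only [pow_zero, pow_one, one_mul] at hc
    exact hc
  have h1 : (1 : R) ∉ annLim x t i ω := by
    rintro ⟨c, hc⟩
    rw [one_smul] at hc
    exact hB c hc
  refine le_antisymm ?_ ?_
  · intro r hr
    have h0 : r ∈ Ie R p (irrIdeal 𝒜) 0 := (Submodule.mem_iInf _).mp hr 0
    exact h0 (AddMonoidHom.id R) (by intro a b; simp)
  · refine le_iInf fun e => Ideal.span_le.mpr fun y hy φ hφ => ?_
    by_contra hu
    have hu' : φ y ∈ annLim x t i ω := by
      obtain ⟨c, hc⟩ := key e y hy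
      refine ⟨c, ?_⟩
      have h2 := aux_B_tr_le x (p ^ e * t) c (p ^ e * c) i
        (Nat.le_mul_of_pos_left c (pow_pos hp.pos e)) _ hc
      rw [← mul_add] at h2
      have h3 := aux_frob_B p e φ hφ x (t + c) i _ h2
      convert h3 using 1
      funext s
      simp only [aux_ktr_apply, Pi.smul_apply, smul_eq_mul]
      rw [mul_comm (p ^ e) c, pow_mul, hφ, mul_comm y, hφ, mul_comm (φ y)]
    obtain ⟨c, hc⟩ := aux_decomp hSG (φ y)
    have hc0 : c ≠ 0 := by
      rintro rfl
      exact hu (by simpa using hc)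
    have h4 : algebraMap K R c ∈ annLim x t i ω := by
      have := Ideal.sub_mem _ hu' (hm hc)
      simpa using this
    apply h1
    have h5 := Ideal.mul_mem_left _ (algebraMap K R c⁻¹) h4
    rwa [← map_mul, inv_mul_cancel₀ hc0, map_one] at h5
end

section
/- Let (R,m,K) be a standard graded K-algebra. If f ∈ R is a homogeneous non-zero divisor of degree d > 0, then d + a_i(R) ≤ a_{i-1}(R/(f)) for all i ∈ N such that H^i_m(R) ≠ 0. -/
/-!
Core definitions: standard graded algebras, Koszul-colimit model of graded local
cohomology nonvanishing, Frobenius splittings, F-purity, F-thresholds.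
-/

open Filter

namespace FT

open scoped Classical in
/-- extension of a cochain by zero to all finsets -/
noncomputable def kext {n k : ℕ} {M : Type*} [AddCommGroup M] (ω : KC n M k)
    (s : Finset (Fin n)) : M :=
  if h : s.card = k then ω ⟨s, h⟩ else 0

theorem kd_apply' {R : Type*} [CommRing R] {n k : ℕ} (f : Fin n → R) (ω : KC n R k)
    (s : {s : Finset (Fin n) // s.card = k + 1}) :
    kd R f k ω s = ∑ i ∈ s.1, (-1 : R) ^ (s.1.filter (fun j => j < i)).card *
      (f i * kext ω (s.1.erase i)) := by
  rw [← Finset.sum_attach s.1]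
  simp only [kd, LinearMap.coe_mk, AddHom.coe_mk]
  refine Finset.sum_congr rfl fun i _ => ?_
  have h : (s.1.erase i.1).card = k := by simp [Finset.card_erase_of_mem i.2, s.2]
  simp [kext, h]

theorem sign_lt {n : ℕ} (s : Finset (Fin n)) (i j : Fin n) (hi : i ∈ s) (hij : i < j) :
    (s.filter (fun l => l < j)).card = ((s.erase i).filter (fun l => l < j)).card + 1 ∧
    ((s.erase j).filter (fun l => l < i)).card = (s.filter (fun l => l < i)).card := by
  constructor
  · rw [Finset.filter_erase]
    rw [Finset.card_erase_add_one]
    simp [hi, hij]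
  · congr 1
    ext l
    simp only [Finset.mem_filter, Finset.mem_erase]
    constructor
    · tauto
    · rintro ⟨h1, h2⟩
      exact ⟨⟨(h2.trans hij).ne, h1⟩, h2⟩

theorem sign_swap {R : Type*} [CommRing R] {n : ℕ} (s : Finset (Fin n)) (i j : Fin n)
    (hi : i ∈ s) (hj : j ∈ s) (hij : i ≠ j) :
    (-1 : R) ^ (s.filter (fun l => l < i)).card *
      (-1 : R) ^ ((s.erase i).filter (fun l => l < j)).card +
    (-1 : R) ^ (s.filter (fun l => l < j)).card *
      (-1 : R) ^ ((s.erase j).filter (fun l => l < i)).card = 0 := by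
  rcases lt_or_gt_of_ne hij with h | h
  · obtain ⟨h1, h2⟩ := sign_lt s i j hi h
    rw [h1, h2]; ring
  · obtain ⟨h1, h2⟩ := sign_lt s j i hj h
    rw [h1, h2]; ring

theorem kd_kd {R : Type*} [CommRing R] {n k : ℕ} (f : Fin n → R) (ω : KC n R k) :
    kd R f (k + 1) (kd R f k ω) = 0 := by
  funext s
  rw [kd_apply']
  have h : ∀ i ∈ s.1, kext (kd R f k ω) (s.1.erase i) =
      ∑ j ∈ s.1.erase i, (-1 : R) ^ ((s.1.erase i).filter (fun l => l < j)).card *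
      (f j * kext ω ((s.1.erase i).erase j)) := by
    intro i hi
    have h : (s.1.erase i).card = k + 1 := by simp [Finset.card_erase_of_mem hi, s.2]
    rw [kext, dif_pos h, kd_apply']
  rw [Finset.sum_congr rfl fun i hi => by rw [h i hi, Finset.mul_sum, Finset.mul_sum],
    Finset.sum_sigma']
  refine Finset.sum_involution (fun p _ => ⟨p.2, p.1⟩) ?_ ?_ ?_ ?_
  · rintro ⟨i, j⟩ hp
    simp only [Finset.mem_sigma, Finset.mem_erase] at hp ⊢
    rw [Finset.erase_right_comm (a := j) (b := i)]
    linear_combination (f i * f j * kext ω ((s.1.erase i).erase j)) *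
      sign_swap (R := R) s.1 i j hp.1 hp.2.2 (Ne.symm hp.2.1)
  · rintro ⟨i, j⟩ hp _ heq
    simp only [Finset.mem_sigma, Finset.mem_erase] at hp
    simp only [Sigma.mk.injEq] at heq
    exact hp.2.1 heq.1
  · rintro ⟨i, j⟩ hp
    simp only [Finset.mem_sigma, Finset.mem_erase] at hp ⊢
    exact ⟨hp.2.2, Ne.symm hp.2.1, hp.1⟩
  · rintro ⟨i, j⟩ hp
    rfl

theorem kd_ktr {R : Type*} [CommRing R] {n k : ℕ} (x : Fin n → R) (t c : ℕ) (ω : KC n R k) :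
    kd R (fun l => x l ^ (t + c)) k (ktr R x c k ω) =
      ktr R x c (k + 1) (kd R (fun l => x l ^ t) k ω) := by
  funext s
  simp only [kd, ktr, LinearMap.coe_mk, AddHom.coe_mk, smul_eq_mul, Finset.mul_sum]
  refine Finset.sum_congr rfl fun i _ => ?_
  rw [← Finset.mul_prod_erase s.1 x i.2]
  simp only [zsmul_eq_mul]
  ring

theorem ktr_ktr {R : Type*} [CommRing R] {n k : ℕ} (x : Fin n → R) (c c' : ℕ) (ω : KC n R k) :
    ktr R x c' k (ktr R x c k ω) = ktr R x (c + c') k ω := by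
  funext s
  simp only [ktr, LinearMap.coe_mk, AddHom.coe_mk, smul_eq_mul]
  ring

theorem kd_map {R S : Type*} [CommRing R] [CommRing S] (φ : R →+* S) {n k : ℕ}
    (x : Fin n → R) (ω : KC n R k) :
    kd S (fun l => φ (x l)) k (fun s => φ (ω s)) = fun s => φ (kd R x k ω s) := by
  funext s
  simp only [kd, LinearMap.coe_mk, AddHom.coe_mk, smul_eq_mul, map_sum, map_zsmul, map_mul]

theorem ktr_map {R S : Type*} [CommRing R] [CommRing S] (φ : R →+* S) {n k : ℕ}
    (x : Fin n → R) (c : ℕ) (ω : KC n R k) :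
    ktr S (fun l => φ (x l)) c k (fun s => φ (ω s)) = fun s => φ (ktr R x c k ω s) := by
  funext s
  simp only [ktr, LinearMap.coe_mk, AddHom.coe_mk, smul_eq_mul, map_pow, map_prod, map_mul]

/-- homogeneous projections onto integer degrees -/
theorem exists_proj {K R : Type*} [Field K] [CommRing R] [Algebra K R]
    (𝒜 : ℕ → Submodule K R) (hSG : IsStandardGraded K R 𝒜) :
    ∃ π : ℤ → R →+ R, (∀ j r, π j r ∈ zdeg 𝒜 j) ∧ (∀ j r, r ∈ zdeg 𝒜 j → π j r = r) ∧
      (∀ (j : ℤ) (T : ℕ) (y r : R), y ∈ 𝒜 T → π (j + T) (y * r) = y * π j r) := by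
  classical
  letI : SetLike.GradedMonoid 𝒜 :=
    { one_mem := by rw [hSG.deg0]; exact Submodule.one_le.mp le_rfl
      mul_mem := fun {i j a b} ha hb => hSG.mul_le i j (Submodule.mul_mem_mul ha hb) }
  letI : DirectSum.Decomposition 𝒜 := hSG.internal.chooseDecomposition
  letI : GradedRing 𝒜 := { }
  refine ⟨fun j => if 0 ≤ j then (GradedRing.proj 𝒜 j.toNat) else 0, ?_, ?_, ?_⟩
  · intro j r
    by_cases h : 0 ≤ j
    · simp [zdeg, h, GradedRing.proj_apply]
    · simp [h]
  · intro j r hr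
    by_cases h : 0 ≤ j
    · simp only [zdeg, h, if_true] at hr ⊢
      rw [GradedRing.proj_apply]
      exact DirectSum.decompose_of_mem_same 𝒜 hr
    · simp only [zdeg, h, if_false, Submodule.mem_bot] at hr
      simp [hr]
  · intro j T y r hy
    by_cases h : 0 ≤ j
    · have h' : 0 ≤ j + T := by omega
      simp only [h, h', if_true, GradedRing.proj_apply]
      have : (j + T).toNat = T + j.toNat := by omega
      rw [this, DirectSum.coe_decompose_mul_add_of_left_mem 𝒜 hy]
    · by_cases h' : 0 ≤ j + T
      · simp only [h, h', if_true, if_false, GradedRing.proj_apply]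
        rw [DirectSum.coe_decompose_mul_of_left_mem_of_not_le 𝒜 hy (by omega)]
        simp
      · simp [h, h']

theorem zdeg_mul {K R : Type*} [Field K] [CommRing R] [Algebra K R]
    (𝒜 : ℕ → Submodule K R) (hSG : IsStandardGraded K R 𝒜) (j : ℤ) (T : ℕ) (y r : R)
    (hy : y ∈ 𝒜 T) (hr : r ∈ zdeg 𝒜 j) : y * r ∈ zdeg 𝒜 (j + T) := by
  obtain ⟨π, h1, h2, h3⟩ := exists_proj 𝒜 hSG
  rw [← h2 j r hr, ← h3 j T y r hy]
  exact h1 _ _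

theorem pow_mem_deg {K R : Type*} [Field K] [CommRing R] [Algebra K R]
    (𝒜 : ℕ → Submodule K R) (hSG : IsStandardGraded K R 𝒜) (y : R) (hy : y ∈ 𝒜 1) (c : ℕ) :
    y ^ c ∈ 𝒜 c := by
  induction c with
  | zero => rw [hSG.deg0, pow_zero]; exact Submodule.one_le.mp le_rfl
  | succ c ih => rw [pow_succ]; exact hSG.mul_le c 1 (Submodule.mul_mem_mul ih hy)

theorem prod_mem_deg {K R : Type*} [Field K] [CommRing R] [Algebra K R]
    (𝒜 : ℕ → Submodule K R) (hSG : IsStandardGraded K R 𝒜) {n : ℕ} (x : Fin n → R)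
    (hx : ∀ l, x l ∈ 𝒜 1) (c : ℕ) (s : Finset (Fin n)) :
    (∏ l ∈ s, x l) ^ c ∈ 𝒜 (c * s.card) := by
  classical
  induction s using Finset.induction_on with
  | empty => simp only [Finset.prod_empty, one_pow, Finset.card_empty, mul_zero]
             rw [hSG.deg0]; exact Submodule.one_le.mp le_rfl
  | insert l s hl ih =>
    rw [Finset.prod_insert hl, mul_pow, Finset.card_insert_of_notMem hl, mul_add, mul_one,
      add_comm]
    exact hSG.mul_le _ _ (Submodule.mul_mem_mul (pow_mem_deg 𝒜 hSG _ (hx l) c) ih)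

theorem KCdeg_ktr {K R : Type*} [Field K] [CommRing R] [Algebra K R]
    (𝒜 : ℕ → Submodule K R) (hSG : IsStandardGraded K R 𝒜) {n : ℕ} (x : Fin n → R)
    (hx : ∀ l, x l ∈ 𝒜 1) (t c k : ℕ) (j : ℤ) (ω : KC n R k) (h : KCdeg 𝒜 t k j ω) :
    KCdeg 𝒜 (t + c) k j (ktr R x c k ω) := by
  intro s
  have := zdeg_mul 𝒜 hSG _ _ _ _ (prod_mem_deg 𝒜 hSG x hx c s.1) (h s)
  rw [s.2] at this
  simp only [ktr, LinearMap.coe_mk, AddHom.coe_mk, smul_eq_mul]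
  convert this using 1
  push_cast
  ring_nf

theorem kd_proj {K R : Type*} [Field K] [CommRing R] [Algebra K R]
    (𝒜 : ℕ → Submodule K R) (π : ℤ → R →+ R)
    (h3 : ∀ (j : ℤ) (T : ℕ) (y r : R), y ∈ 𝒜 T → π (j + T) (y * r) = y * π j r)
    {n k : ℕ} (x : Fin n → R) (T : ℕ) (hx : ∀ l, x l ∈ 𝒜 T) (j : ℤ) (η : KC n R k) :
    kd R x k (fun s => π j (η s)) = fun s => π (j + T) (kd R x k η s) := by
  funext s
  simp only [kd, LinearMap.coe_mk, AddHom.coe_mk, smul_eq_mul, map_sum, map_zsmul]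
  refine Finset.sum_congr rfl fun i _ => ?_
  rw [h3 _ _ _ _ (hx _)]

end FT

open FT in
/-- Let `(R, m, K)` be a standard graded `K`-algebra.  If `f` is a
homogeneous non-zero divisor of degree `d > 0`, then `d + a_i(R) ≤ a_{i-1}(R/(f))` for
all `i` with `H^i_m(R) ≠ 0` — formalized as: if `a = a_i(R)`, then the degree-`b`
graded piece of `H^{i-1}_{m}(R/(f))` is nonzero for some `b ≥ d + a`.  The quotient
`R/(f)` carries the induced grading. -/
theorem deg_add_aInv_le_aInv_quotient
    (K R : Type*) [Field K] [CommRing R] [Algebra K R]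
    (𝒜 : ℕ → Submodule K R) (hSG : IsStandardGraded K R 𝒜)
    (f : R) (d : ℕ) (hd : 0 < d) (hf : f ∈ 𝒜 d) (hreg : f ∈ nonZeroDivisors R)
    (i : ℕ) (a : ℤ) (ha : IsGreatest {j : ℤ | lcNonzero K R 𝒜 i j} a) :
    ∃ b : ℤ,
      lcNonzero K (R ⧸ Ideal.span {f})
        (fun k => (𝒜 k).map (Ideal.Quotient.mkₐ K (Ideal.span {f})).toLinearMap)
        (i - 1) b ∧
      a + (d : ℤ) ≤ b := by
  obtain ⟨⟨n, x, hx, hspan, t, ω, ht, hZ, hdeg, hne⟩, hmax⟩ := ha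
  -- `f • ω` dies in the limit
  have hdie : ∃ c : ℕ, ktr R x c i (f • ω) ∈ koszulB R (fun l => x l ^ (t + c)) i := by
    by_contra! hcon
    have : a + (d : ℤ) ≤ a := by
      apply hmax
      refine ⟨n, x, hx, hspan, t, f • ω, ht, Submodule.smul_mem _ _ hZ, ?_, hcon⟩
      intro s
      have := zdeg_mul 𝒜 hSG _ _ _ _ hf (hdeg s)
      rw [Pi.smul_apply, smul_eq_mul]
      convert this using 1
      ring_nf
    omega
  obtain ⟨c, hc⟩ := hdie
  have hcanc : ∀ r r' : R, f * r = f * r' → r = r' := fun r r' h =>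
    (mem_nonZeroDivisors_iff_right.mp hreg |> fun H => by
      have := H (r - r') (by linear_combination h)
      exact sub_eq_zero.mp this)
  cases i with
  | zero =>
    exfalso
    apply hne c
    change _ = _ at hc
    change _ = _
    funext s
    have := congrFun hc s
    rw [map_smul] at this
    apply hcanc
    simpa using this
  | succ k =>
    obtain ⟨η₀, hη₀⟩ := hc
    obtain ⟨π, h1, h2, h3⟩ := exists_proj 𝒜 hSG
    obtain ⟨η, hηdeg, hη⟩ : ∃ η : KC n R k, KCdeg 𝒜 (t + c) k (a + d) η ∧
        kd R (fun l => x l ^ (t + c)) k η = f • ktr R x c (k + 1) ω := by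
      refine ⟨fun s => π (a + d + (t + c : ℕ) * k) (η₀ s), fun s => h1 _ _, ?_⟩
      rw [kd_proj 𝒜 π h3 (fun l => x l ^ (t + c)) (t + c)
        (fun l => pow_mem_deg 𝒜 hSG _ (hx l) _), hη₀, map_smul]
      funext s
      apply h2
      have := zdeg_mul 𝒜 hSG _ _ _ _ hf (KCdeg_ktr 𝒜 hSG x hx t c (k + 1) a ω hdeg s)
      rw [Pi.smul_apply, smul_eq_mul]
      convert this using 1
      push_cast
      ring_nf
    set φ : R →+* R ⧸ Ideal.span {f} := Ideal.Quotient.mk (Ideal.span {f}) with hφ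
    have hφf : ∀ r, φ (f * r) = 0 := fun r => by
      rw [hφ, Ideal.Quotient.eq_zero_iff_mem]
      exact Ideal.mul_mem_right _ _ (Ideal.mem_span_singleton_self f)
    have hlift : ∀ (m : ℕ) (θ : KC n R m), (∀ s, φ (θ s) = 0) → ∃ η' : KC n R m, θ = f • η' := by
      intro m θ h
      have : ∀ s, ∃ r, θ s = f * r := fun s => by
        have := h s
        rwa [hφ, Ideal.Quotient.eq_zero_iff_mem, Ideal.mem_span_singleton] at this
      choose g hg using this
      exact ⟨g, funext hg⟩
    refine ⟨a + d, ⟨n, fun l => φ (x l), fun l => ⟨x l, hx l, rfl⟩, ?_, t + c,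
      fun s => φ (η s), by omega, ?_, ?_, ?_⟩, le_rfl⟩
    · have := congrArg (Ideal.map φ) hspan
      rw [Ideal.map_span, Ideal.map_span, ← Set.range_comp] at this
      exact this
    · change kd _ _ _ _ = 0
      have := kd_map φ (fun l => x l ^ (t + c)) η
      simp only [map_pow] at this
      refine this.trans ?_
      rw [hη]
      funext s
      exact hφf _
    · intro s
      have := hηdeg s
      change φ (η s) ∈ _
      by_cases h : 0 ≤ a + (d : ℤ) + (t + c : ℕ) * k
      · simp only [zdeg, Nat.add_sub_cancel, h, if_true] at this ⊢
        exact ⟨_, this, rfl⟩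
      · simp only [zdeg, Nat.add_sub_cancel, h, if_false, Submodule.mem_bot] at this ⊢
        rw [this, map_zero]
    · intro c' hB
      have key : ∃ η' : KC n R k, kd R (fun l => x l ^ (t + c + c')) k (ktr R x c' k η) =
          f • kd R (fun l => x l ^ (t + c + c')) k η' := by
        change ktr _ _ c' k _ ∈ koszulB _ _ k at hB
        have e := ktr_map φ x c' η
        cases k with
        | zero =>
          change _ = _ at hB
          obtain ⟨η', h⟩ := hlift _ (ktr R x c' 0 η) (fun s => congrFun (e.symm.trans hB) s)
          exact ⟨η', by rw [h, map_smul]⟩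
        | succ l =>
          obtain ⟨θ', hθ'⟩ := hB
          choose θ hθ using fun s => Ideal.Quotient.mk_surjective (θ' s)
          have e2 := kd_map φ (fun l => x l ^ (t + c + c')) θ
          simp only [map_pow] at e2
          obtain rfl : (fun s => φ (θ s)) = θ' := funext hθ
          have e3 := (e2.symm.trans hθ').trans e
          obtain ⟨η', h⟩ := hlift _ (ktr R x c' (l + 1) η -
              kd R (fun l => x l ^ (t + c + c')) l θ) (fun s => by
            rw [Pi.sub_apply, map_sub, sub_eq_zero]
            exact (congrFun e3 s).symm)
          refine ⟨η', ?_⟩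
          rw [← map_smul, ← h, map_sub, kd_kd, sub_zero]
      obtain ⟨η', h⟩ := key
      rw [kd_ktr, hη, map_smul, ktr_ktr] at h
      apply hne (c + c')
      refine ⟨η', ?_⟩
      rw [← add_assoc]
      funext s
      exact (hcanc _ _ (congrFun h s)).symm
end

section
/- Let (R,m,K) be a standard graded K-algebra of characteristic p > 0 which is F-finite and F-pure. If f_1,...,f_r is a homogeneous F-pure regular sequence of degrees d_1,...,d_r, then d_1 + ... + d_r ≤ min{-a_i(R) : i ∈ N}. -/
/-!
Core definitions: standard graded algebras, Koszul-colimit model of graded local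
cohomology nonvanishing, Frobenius splittings, F-purity, F-thresholds.
-/

open Filter

namespace FTP
open FT

section Koszul
variable {R : Type*} [CommRing R] {n : ℕ}

def sg (a : Fin n) (s : Finset (Fin n)) : ℕ := (s.filter (fun j => j < a)).card

def D (f : Fin n → R) : (Finset (Fin n) → R) →ₗ[R] (Finset (Fin n) → R) where
  toFun W s := ∑ i ∈ s, ((-1) ^ sg i s * f i) * W (s.erase i)
  map_add' a b := by
    funext s
    simp [mul_add, Finset.sum_add_distrib]
  map_smul' r a := by
    funext s
    simp only [Pi.smul_apply, RingHom.id_apply, smul_eq_mul, Finset.mul_sum]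
    refine Finset.sum_congr rfl fun i _ => ?_
    ring

def tr (x : Fin n → R) (c : ℕ) : (Finset (Fin n) → R) →ₗ[R] (Finset (Fin n) → R) where
  toFun W s := (∏ i ∈ s, x i) ^ c * W s
  map_add' a b := by funext s; simp [mul_add]
  map_smul' r a := by
    funext s
    simp only [Pi.smul_apply, RingHom.id_apply, smul_eq_mul]
    ring

def pw (x : Fin n → R) (t : ℕ) : Fin n → R := fun l => x l ^ t

def pj (n : ℕ) (J : Ideal R) : Submodule R (Finset (Fin n) → R) := Submodule.pi Set.univ fun _ => J

lemma mem_pj {J : Ideal R} {W : Finset (Fin n) → R} : W ∈ pj n J ↔ ∀ s, W s ∈ J := by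
  simp [pj, Submodule.mem_pi]

lemma D_apply (f : Fin n → R) (W : Finset (Fin n) → R) (s) :
    D f W s = ∑ i ∈ s, ((-1) ^ sg i s * f i) * W (s.erase i) := rfl

lemma tr_apply (f : Fin n → R) (c : ℕ) (W : Finset (Fin n) → R) (s) :
    tr f c W s = (∏ i ∈ s, f i) ^ c * W s := rfl

lemma D_mem {J : Ideal R} (f : Fin n → R) {W : Finset (Fin n) → R} (h : W ∈ pj n J) :
    D f W ∈ pj n J := by
  rw [mem_pj] at *
  intro s
  exact J.sum_mem fun i _ => J.mul_mem_left _ (h _)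

lemma tr_mem {J : Ideal R} (f : Fin n → R) (c : ℕ) {W : Finset (Fin n) → R} (h : W ∈ pj n J) :
    tr f c W ∈ pj n J := by
  rw [mem_pj] at *
  intro s
  exact J.mul_mem_left _ (h _)

lemma tr_tr (x : Fin n → R) (c c' : ℕ) (W) : tr x c' (tr x c W) = tr x (c + c') W := by
  funext s
  simp only [tr_apply, pow_add]
  ring

lemma tr_D (x : Fin n → R) (t c : ℕ) (W) :
    tr x c (D (pw x t) W) = D (pw x (t + c)) (tr x c W) := by
  funext s
  simp only [tr_apply, D_apply, pw, Finset.mul_sum]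
  refine Finset.sum_congr rfl fun i hi => ?_
  rw [← Finset.mul_prod_erase s x hi, mul_pow, pow_add]
  ring

lemma sg_erase_of_le {a b : Fin n} (h : a ≤ b) (s : Finset (Fin n)) :
    sg a (s.erase b) = sg a s := by
  unfold sg
  congr 1
  ext j
  simp only [Finset.mem_filter, Finset.mem_erase]
  constructor
  · rintro ⟨⟨_, h1⟩, h2⟩; exact ⟨h1, h2⟩
  · rintro ⟨h1, h2⟩; exact ⟨⟨by rintro rfl; exact absurd h2 (not_lt.2 h), h1⟩, h2⟩

lemma sg_erase_of_lt {a b : Fin n} (h : a < b) {s : Finset (Fin n)} (ha : a ∈ s) :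
    sg b s = sg b (s.erase a) + 1 := by
  unfold sg
  rw [Finset.filter_erase, Finset.card_erase_add_one]
  simp [ha, h]

lemma sgn_swap {a b : Fin n} (h : a ≠ b) {s : Finset (Fin n)} (ha : a ∈ s) (hb : b ∈ s) :
    (-1 : R) ^ sg a s * (-1) ^ sg b (s.erase a) = - ((-1) ^ sg b s * (-1) ^ sg a (s.erase b)) := by
  rcases lt_or_gt_of_ne h with h | h
  · rw [sg_erase_of_lt h ha, sg_erase_of_le h.le s]; ring
  · rw [sg_erase_of_lt h hb, sg_erase_of_le h.le s]; ring

lemma D_D (f : Fin n → R) (W) : D f (D f W) = 0 := by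
  funext s
  simp only [D_apply, Finset.mul_sum, Pi.zero_apply]
  rw [Finset.sum_sigma']
  refine Finset.sum_involution (fun a _ => ⟨a.2, a.1⟩) ?_ ?_ ?_ ?_
  · rintro ⟨a, b⟩ h
    simp only [Finset.mem_sigma, Finset.mem_erase] at h
    obtain ⟨ha, hba, hb⟩ := h
    have := sgn_swap (R := R) hba.symm ha hb
    simp only
    rw [Finset.erase_right_comm (a := b) (b := a)]
    linear_combination (f a * f b * W ((s.erase a).erase b)) * this
  · rintro ⟨a, b⟩ h _ h2
    simp only [Finset.mem_sigma, Finset.mem_erase] at h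
    simp only [Sigma.mk.injEq] at h2
    exact h.2.1 h2.1
  · rintro ⟨a, b⟩ h
    simp only [Finset.mem_sigma, Finset.mem_erase] at h ⊢
    exact ⟨h.2.2, h.2.1.symm, h.1⟩
  · rintro ⟨a, b⟩ h; rfl

def ht (l : Fin n) (W : Finset (Fin n) → R) : Finset (Fin n) → R := fun s =>
  if l ∈ s then 0 else (-1) ^ sg l s * W (insert l s)

lemma homotopy (f : Fin n → R) (l : Fin n) (W) :
    D f (ht l W) + ht l (D f W) = f l • W := by
  have h1 : ∀ k : ℕ, (-1 : R) ^ k * (-1) ^ k = 1 := fun k => by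
    rw [← mul_pow]; simp
  funext s
  simp only [Pi.add_apply, Pi.smul_apply, smul_eq_mul]
  by_cases hl : l ∈ s
  · rw [D_apply, ht, if_pos hl, add_zero, Finset.sum_eq_single l]
    · simp only [ht, Finset.mem_erase, ne_eq, not_true_eq_false, false_and, if_false,
        Finset.insert_erase hl, sg_erase_of_le le_rfl]
      linear_combination (f l * W s) * h1 (sg l s)
    · intro b hb hbl
      simp [ht, hl, Ne.symm hbl]
    · exact fun h => absurd hl h
  · rw [ht, if_neg hl, D_apply, D_apply, Finset.sum_insert hl, Finset.erase_insert hl, mul_add,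
      Finset.mul_sum]
    have e1 : sg l (insert l s) = sg l s := by
      rw [← sg_erase_of_le (le_refl l) (insert l s), Finset.erase_insert hl]
    have : ∑ i ∈ s, ((-1) ^ sg i s * f i) * ht l W (s.erase i) +
      ∑ i ∈ s, (-1) ^ sg l s * ((-1) ^ sg i (insert l s) * f i * W ((insert l s).erase i)) = 0 := by
      rw [← Finset.sum_add_distrib]
      refine Finset.sum_eq_zero fun i hi => ?_
      have hne : i ≠ l := fun h => hl (h ▸ hi)
      have e2 := sgn_swap (R := R) hne (s := insert l s) (Finset.mem_insert_of_mem hi)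
        (Finset.mem_insert_self _ _)
      have e4 : (insert l s).erase i = insert l (s.erase i) :=
        Finset.erase_insert_of_ne hne.symm
      have e3 : sg l ((insert l s).erase i) = sg l (s.erase i) := by
        rw [← sg_erase_of_le (le_refl l) ((insert l s).erase i), e4, Finset.erase_insert]
        simp [hl]
      rw [e3, e1, Finset.erase_insert hl] at e2
      have hl' : l ∉ s.erase i := by simp [hl]
      simp only [ht, if_neg hl', e4]
      have e5 : (-1 : R) ^ sg i s * (-1) ^ sg l (s.erase i) + (-1) ^ sg l s * (-1) ^ sg i (insert l s) = 0 := by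
        have a1 := h1 (sg l s)
        have a2 := h1 (sg l (s.erase i))
        rcases neg_one_pow_eq_or R (sg l s) with q1 | q1 <;>
        rcases neg_one_pow_eq_or R (sg l (s.erase i)) with q2 | q2 <;>
        rw [q1, q2] at e2 ⊢ <;> first | linear_combination e2 | linear_combination -e2
      linear_combination (f i * W (insert l (s.erase i))) * e5
    rw [e1]
    linear_combination this + (f l * W s) * h1 (sg l s)

end Koszul

section Gr
variable {K R : Type*} [Field K] [CommRing R] [Algebra K R]
variable (𝒜 : ℕ → Submodule K R) [GradedAlgebra 𝒜] {n : ℕ}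

lemma mem_zdeg {e : ℤ} {r : R} : r ∈ zdeg 𝒜 e ↔ (if 0 ≤ e then r ∈ 𝒜 e.toNat else r = 0) := by
  unfold zdeg
  split_ifs <;> simp

lemma zdeg_mul {d : ℕ} {e e' : ℤ} {a b : R} (ha : a ∈ 𝒜 d) (hb : b ∈ zdeg 𝒜 e) (he : e' = e + d) :
    a * b ∈ zdeg 𝒜 e' := by
  subst he
  by_cases h : 0 ≤ e
  · rw [mem_zdeg, if_pos h] at hb
    rw [mem_zdeg, if_pos (by omega)]
    have := SetLike.mul_mem_graded ha hb
    rwa [show (e + d).toNat = d + e.toNat by omega]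
  · rw [mem_zdeg, if_neg h] at hb
    rw [hb, mul_zero]
    exact zero_mem _

noncomputable def zp (e : ℤ) : R →+ R :=
  if 0 ≤ e then GradedRing.proj 𝒜 e.toNat else 0

lemma zp_mem (e : ℤ) (r : R) : zp 𝒜 e r ∈ zdeg 𝒜 e := by
  rw [mem_zdeg]
  unfold zp
  split_ifs
  · rw [GradedRing.proj_apply]; exact SetLike.coe_mem _
  · rfl

lemma zp_of_mem {e : ℤ} {r : R} (h : r ∈ zdeg 𝒜 e) : zp 𝒜 e r = r := by
  rw [mem_zdeg] at h
  unfold zp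
  split_ifs at h ⊢
  · rw [GradedRing.proj_apply, DirectSum.decompose_of_mem_same _ h]
  · rw [h]; rfl

lemma zp_mul {d : ℕ} {e e' : ℤ} {a : R} (ha : a ∈ 𝒜 d) (b : R) (he : e' = e + d) :
    zp 𝒜 e' (a * b) = a * zp 𝒜 e b := by
  subst he
  unfold zp
  by_cases h : 0 ≤ e
  · rw [if_pos h, if_pos (by omega), GradedRing.proj_apply, GradedRing.proj_apply,
      show (e + d).toNat = d + e.toNat by omega, DirectSum.coe_decompose_mul_add_of_left_mem 𝒜 ha]
  · rw [if_neg h]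
    by_cases h' : 0 ≤ e + d
    · rw [if_pos h', GradedRing.proj_apply,
        DirectSum.coe_decompose_mul_of_left_mem_of_not_le 𝒜 ha (by omega)]
      simp
    · rw [if_neg h']; simp

lemma zp_ideal {J : Ideal R} (hJ : J.IsHomogeneous 𝒜) (e : ℤ) {r : R} (h : r ∈ J) :
    zp 𝒜 e r ∈ J := by
  unfold zp
  split_ifs
  · exact hJ _ h
  · exact J.zero_mem

def Hg (t : ℕ) (j : ℤ) (W : Finset (Fin n) → R) : Prop := ∀ s, W s ∈ zdeg 𝒜 (j + t * s.card)

variable {𝒜}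

lemma Hg.add {t : ℕ} {j : ℤ} {W W' : Finset (Fin n) → R} (h : Hg 𝒜 t j W) (h' : Hg 𝒜 t j W') :
    Hg 𝒜 t j (W + W') := fun s => add_mem (h s) (h' s)

lemma Hg.sub {t : ℕ} {j : ℤ} {W W' : Finset (Fin n) → R} (h : Hg 𝒜 t j W) (h' : Hg 𝒜 t j W') :
    Hg 𝒜 t j (W - W') := fun s => sub_mem (h s) (h' s)

lemma sgn_mem (k : ℕ) {d : ℕ} {a : R} (ha : a ∈ 𝒜 d) : (-1) ^ k * a ∈ 𝒜 d := by
  rcases neg_one_pow_eq_or R k with h | h <;> rw [h]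
  · simpa using ha
  · simpa using ha

lemma pw_mem {x : Fin n → R} (hx : ∀ l, x l ∈ 𝒜 1) (t : ℕ) (l) : pw x t l ∈ 𝒜 t := by
  have := SetLike.pow_mem_graded t (hx l)
  simpa [pw] using this

lemma Hg.D {x : Fin n → R} (hx : ∀ l, x l ∈ 𝒜 1) {t : ℕ} {j : ℤ} {W : Finset (Fin n) → R}
    (h : Hg 𝒜 t j W) : Hg 𝒜 t j (D (pw x t) W) := by
  intro s
  rw [D_apply]
  refine sum_mem fun i hi => zdeg_mul 𝒜 (sgn_mem _ (pw_mem hx t i)) (h _) ?_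
  have := Finset.card_erase_add_one hi
  rw [← this]; push_cast; ring

lemma prod_mem {x : Fin n → R} (hx : ∀ l, x l ∈ 𝒜 1) (c : ℕ) (s : Finset (Fin n)) :
    (∏ i ∈ s, x i) ^ c ∈ 𝒜 (c * s.card) := by
  have h1 : ∏ i ∈ s, x i ∈ 𝒜 (s.card) := by
    have := SetLike.prod_mem_graded 𝒜 (fun _ => 1) x (F := s) (fun i _ => hx i)
    simpa using this
  simpa using SetLike.pow_mem_graded c h1

lemma Hg.tr {x : Fin n → R} (hx : ∀ l, x l ∈ 𝒜 1) {t : ℕ} {j : ℤ} {W : Finset (Fin n) → R}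
    (c : ℕ) (h : Hg 𝒜 t j W) : Hg 𝒜 (t + c) j (tr x c W) := by
  intro s
  rw [tr_apply]
  refine zdeg_mul 𝒜 (prod_mem hx c s) (h s) ?_
  push_cast; ring

lemma Hg.smul {t d : ℕ} {j : ℤ} {W : Finset (Fin n) → R} {y : R} (hy : y ∈ 𝒜 d)
    (h : Hg 𝒜 t j W) : Hg 𝒜 t (j + d) (y • W) := by
  intro s
  exact zdeg_mul 𝒜 hy (h s) (by ring)

variable (𝒜)

def EvB (x : Fin n → R) (I J : Ideal R) (t : ℕ) (j : ℤ) (W : Finset (Fin n) → R) : Prop :=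
  ∃ (c : ℕ) (η : Finset (Fin n) → R), η ∈ pj n I ∧ Hg 𝒜 (t + c) j η ∧
    tr x c W - D (pw x (t + c)) η ∈ pj n J

def V (x : Fin n → R) (I J : Ideal R) (j : ℤ) : Prop :=
  ∀ (t : ℕ) (W : Finset (Fin n) → R), W ∈ pj n I → Hg 𝒜 t j W → D (pw x t) W ∈ pj n J →
    EvB 𝒜 x I J t j W

def col (J : Ideal R) (y : R) : Ideal R := Submodule.comap (LinearMap.mulLeft R y) J

lemma mem_col {J : Ideal R} {y r : R} : r ∈ col J y ↔ y * r ∈ J := by simp [col]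

lemma col_homog {J : Ideal R} (hJ : J.IsHomogeneous 𝒜) {y : R} {d : ℕ} (hy : y ∈ 𝒜 d) :
    (col J y).IsHomogeneous 𝒜 := by
  intro i r hr
  rw [mem_col] at *
  rw [← DirectSum.coe_decompose_mul_add_of_left_mem 𝒜 hy]
  exact hJ _ hr

lemma dec {I J : Ideal R} (hI : I.IsHomogeneous 𝒜) (hJ : J.IsHomogeneous 𝒜) {y : R} {d : ℕ}
    (hy : y ∈ 𝒜 d) {u : R} {e e' : ℤ} (he : e' = e + d) (hu : u ∈ zdeg 𝒜 e')
    (h : u ∈ J ⊔ Ideal.span {y} * I) : ∃ b ∈ I, b ∈ zdeg 𝒜 e ∧ u - y * b ∈ J := by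
  obtain ⟨a, ha, w, hw, rfl⟩ := Submodule.mem_sup.1 h
  obtain ⟨b, hb, rfl⟩ := Ideal.mem_span_singleton_mul.1 hw
  refine ⟨zp 𝒜 e b, zp_ideal 𝒜 hI _ hb, zp_mem 𝒜 _ _, ?_⟩
  rw [← zp_of_mem 𝒜 hu, map_add, zp_mul 𝒜 hy b he, add_sub_cancel_right]
  exact zp_ideal 𝒜 hJ _ ha

lemma step {x : Fin n → R} (hx : ∀ l, x l ∈ 𝒜 1) {I J : Ideal R} (hI : I.IsHomogeneous 𝒜)
    (hJ : J.IsHomogeneous 𝒜) (hJI : J ≤ I) {y : R} {d : ℕ} (hy : y ∈ 𝒜 d) {j : ℤ}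
    (h1 : V 𝒜 x (I ⊓ col J y) J j) (h2 : V 𝒜 x I (J ⊔ Ideal.span {y} * I) (j + d))
    {t : ℕ} {W : Finset (Fin n) → R} (hWI : W ∈ pj n I) (hW : Hg 𝒜 t j W)
    (hDW : D (pw x t) W ∈ pj n J) (hE : EvB 𝒜 x I J t (j + d) (y • W)) : EvB 𝒜 x I J t j W := by
  obtain ⟨c, η, hηI, hη, hηW⟩ := hE
  have hyI : ∀ {U}, U ∈ pj n I → y • U ∈ pj n (J ⊔ Ideal.span {y} * I) := by
    intro U hU
    rw [mem_pj] at *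
    intro s
    exact Ideal.mem_sup_right (Ideal.mul_mem_mul (Ideal.mem_span_singleton_self y) (hU s))
  have hJle : pj n J ≤ pj n (J ⊔ Ideal.span {y} * I) := by
    intro U hU
    rw [mem_pj] at *
    intro s
    exact Ideal.mem_sup_left (hU s)
  have hDη : D (pw x (t + c)) η ∈ pj n (J ⊔ Ideal.span {y} * I) := by
    have : D (pw x (t + c)) η = y • tr x c W - (tr x c (y • W) - D (pw x (t + c)) η) := by
      rw [map_smul]; abel
    rw [this]
    exact sub_mem (hyI (tr_mem _ _ hWI)) (hJle hηW)
  obtain ⟨c', ζ, hζI, hζ, hζη⟩ := h2 _ η hηI hη hDη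
  have hu := (Hg.tr hx c' hη).sub (Hg.D hx hζ)
  rw [mem_pj] at hζη
  choose θ hθI hθ hθJ using fun s =>
    dec 𝒜 hI hJ hy (e := j + ((t + c + c' : ℕ) : ℤ) * s.card) (by ring) (hu s) (hζη s)
  have hθI' : θ ∈ pj n I := mem_pj.2 hθI
  have hθJ' : tr x c' η - D (pw x (t + c + c')) ζ - y • θ ∈ pj n J := mem_pj.2 hθJ
  set T := t + c + c' with hT
  have hT' : t + (c + c') = T := by omega
  have hW2 : Hg 𝒜 T j (tr x (c + c') W - D (pw x T) θ) := by
    refine Hg.sub ?_ (Hg.D hx hθ)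
    have := Hg.tr hx (c + c') hW
    rwa [hT'] at this
  have hW2I : tr x (c + c') W - D (pw x T) θ ∈ pj n (I ⊓ col J y) := by
    have a1 : tr x (c + c') W - D (pw x T) θ ∈ pj n I :=
      sub_mem (tr_mem _ _ hWI) (D_mem _ hθI')
    have a2 : y • (tr x (c + c') W - D (pw x T) θ) ∈ pj n J := by
      have b1 := tr_mem x c' hηW
      have b2 := D_mem (pw x T) hθJ'
      have b3 := add_mem b1 b2
      rw [map_sub, tr_D, map_sub, map_sub, D_D, tr_tr] at b3
      convert b3 using 1
      simp only [map_smul, smul_sub]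
      abel
    rw [mem_pj] at *
    exact fun s => ⟨a1 s, mem_col.2 (a2 s)⟩
  have hDW2 : D (pw x T) (tr x (c + c') W - D (pw x T) θ) ∈ pj n J := by
    rw [map_sub, D_D, sub_zero, ← hT', ← tr_D]
    exact tr_mem _ _ hDW
  obtain ⟨c'', ξ, hξI, hξ, hξW⟩ := h1 _ _ hW2I hW2 hDW2
  have hT'' : t + (c + c' + c'') = T + c'' := by omega
  refine ⟨c + c' + c'', tr x c'' θ + ξ, add_mem (tr_mem _ _ hθI') ?_, ?_, ?_⟩
  · rw [mem_pj] at *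
    exact fun s => (hξI s).1
  · rw [hT'']
    exact (Hg.tr hx c'' hθ).add hξ
  · rw [hT'']
    convert hξW using 1
    rw [map_sub, tr_tr, tr_D, map_add]
    abel

lemma V_trivial {x : Fin n → R} {I J : Ideal R} {j : ℤ}
    (h : ∀ (t : ℕ) (s : Finset (Fin n)) (r : R), r ∈ I → r ∈ zdeg 𝒜 (j + t * s.card) → r ∈ J) :
    V 𝒜 x I J j := by
  intro t W hWI hW _
  refine ⟨0, 0, zero_mem _, fun s => zero_mem _, ?_⟩
  rw [mem_pj] at *
  intro s
  simpa [tr_apply] using h t s _ (hWI s) (hW s)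

lemma bounded_base [IsNoetherianRing R] {x : Fin n → R}
    (hm : ∀ d, 0 < d → ∀ a ∈ 𝒜 d, a ∈ Ideal.span (Set.range x))
    {I J : Ideal R} (hI : I.IsHomogeneous 𝒜) 
    (h : ∀ l, ∀ r ∈ I, x l * r ∈ J) : ∃ C : ℤ, ∀ j > C, V 𝒜 x I J j := by
  classical
  have hmI : ∀ a ∈ Ideal.span (Set.range x), ∀ r ∈ I, a * r ∈ J := by
    intro a ha r hr
    induction ha using Submodule.span_induction with
    | mem a ha => obtain ⟨l, rfl⟩ := ha; exact h l r hr
    | zero => simp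
    | add a b _ _ h1 h2 => rw [add_mul]; exact J.add_mem h1 h2
    | smul a b _ h1 => rw [smul_eq_mul, mul_assoc]; exact J.mul_mem_left _ h1
  obtain ⟨S, hS⟩ := IsNoetherian.noetherian I
  let C : ℕ := S.sup fun g => (DirectSum.decompose 𝒜 g).support.sup id
  have key : ∀ r ∈ I, ∀ a : R, ∀ d > C, GradedRing.proj 𝒜 d (a * r) ∈ J := by
    intro r hr
    rw [← hS] at hr
    induction hr using Submodule.span_induction with
    | zero => simp
    | add a b _ _ h1 h2 =>
      intro c d hd
      rw [mul_add, map_add]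
      exact J.add_mem (h1 c d hd) (h2 c d hd)
    | smul a b _ h1 =>
      intro c d hd
      rw [smul_eq_mul, ← mul_assoc]; exact h1 _ d hd
    | mem g hg =>
      intro a d hd
      have hgI : g ∈ I := hS ▸ Ideal.subset_span hg
      rw [← DirectSum.sum_support_decompose 𝒜 g, Finset.mul_sum, map_sum]
      refine J.sum_mem fun e he => ?_
      have heC : e ≤ C := le_trans (Finset.le_sup (f := id) he)
        (Finset.le_sup (f := fun g => (DirectSum.decompose 𝒜 g).support.sup id) hg)
      rw [GradedRing.proj_apply, mul_comm,
        DirectSum.coe_decompose_mul_of_left_mem_of_le 𝒜 (SetLike.coe_mem _) (by omega), mul_comm]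
      exact hmI _ (hm (d - e) (by omega) _ (SetLike.coe_mem _)) _ (hI _ hgI)
  refine ⟨C, fun j hj => V_trivial 𝒜 fun t s r hr hd => ?_⟩
  have h0 : (0 : ℤ) ≤ t * s.card := by positivity
  rw [mem_zdeg, if_pos (by omega)] at hd
  have := key r hr 1 (j + t * s.card).toNat (by omega)
  rwa [one_mul, GradedRing.proj_apply, DirectSum.decompose_of_mem_same _ hd] at this

lemma EvB_pow {x : Fin n → R} (hx : ∀ l, x l ∈ 𝒜 1) {I J : Ideal R} {t : ℕ} {j : ℤ} (l : Fin n)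
    {W : Finset (Fin n) → R} (hWI : W ∈ pj n I) (hW : Hg 𝒜 t j W)
    (hDW : D (pw x t) W ∈ pj n J) : EvB 𝒜 x I J t (j + t) (x l ^ t • W) := by
  refine ⟨0, ht l W, ?_, ?_, ?_⟩
  · rw [mem_pj] at *
    intro s
    unfold ht
    split_ifs
    · exact I.zero_mem
    · exact I.mul_mem_left _ (hWI _)
  · intro s
    unfold ht
    split_ifs with h
    · exact zero_mem _
    · refine zdeg_mul 𝒜 (sgn_mem (𝒜 := 𝒜) (d := 0) _ SetLike.GradedOne.one_mem |> fun h => by simpa using h) (hW _) ?_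
      rw [Finset.card_insert_of_notMem h]; push_cast; ring
  · have := homotopy (pw x t) l W
    have e : tr x 0 (x l ^ t • W) = x l ^ t • W := by funext s; simp [tr_apply]
    rw [e]
    change pw x t l • W - _ ∈ _
    rw [← this, add_zero, add_sub_cancel_left]
    rw [mem_pj] at *
    intro s
    unfold ht
    split_ifs
    · exact J.zero_mem
    · exact J.mul_mem_left _ (hDW _)

lemma bounded [IsNoetherianRing R] {x : Fin n → R} (hx : ∀ l, x l ∈ 𝒜 1)
    (hm : ∀ d, 0 < d → ∀ a ∈ 𝒜 d, a ∈ Ideal.span (Set.range x)) (T : Finset (Fin n)) :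
    ∀ (I J : Ideal R), I.IsHomogeneous 𝒜 → J.IsHomogeneous 𝒜 → J ≤ I →
    (∀ l ∉ T, ∀ r ∈ I, x l * r ∈ J) → ∃ C : ℤ, ∀ j > C, V 𝒜 x I J j := by
  induction T using Finset.induction_on with
  | empty =>
    intro I J hI hJ _ h
    exact bounded_base 𝒜 hm hI fun l => h l (by simp)
  | insert l T _ ih =>
    intro I J hI hJ hJI h
    have hsp : (Ideal.span {x l}).IsHomogeneous 𝒜 := by
      refine Ideal.homogeneous_span 𝒜 _ ?_
      rintro _ rfl
      exact ⟨1, hx l⟩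
    obtain ⟨C1, h1⟩ := ih (I ⊓ col J (x l)) J (hI.inf (col_homog 𝒜 hJ (hx l))) hJ
      (le_inf hJI fun r hr => mem_col.2 (J.mul_mem_left _ hr)) (by
        intro l' hl' r hr
        by_cases e : l' = l
        · subst e; exact mem_col.1 hr.2
        · exact h l' (by simp [e, hl']) r hr.1)
    obtain ⟨C2, h2⟩ := ih I (J ⊔ Ideal.span {x l} * I) hI (hJ.sup (hsp.mul hI))
      (sup_le hJI Ideal.mul_le_right) (by
        intro l' hl' r hr
        by_cases e : l' = l
        · subst e
          exact Ideal.mem_sup_right (Ideal.mul_mem_mul (Ideal.mem_span_singleton_self _) hr)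
        · exact Ideal.mem_sup_left (h l' (by simp [e, hl']) r hr))
    refine ⟨max C1 C2, fun j hj t W hWI hW hDW => ?_⟩
    have : ∀ m : ℕ, EvB 𝒜 x I J t (j + m) (x l ^ m • W) → EvB 𝒜 x I J t j W := by
      intro m
      induction m with
      | zero => simp
      | succ m ihm =>
        intro hE
        refine ihm ?_
        have hm' : x l ^ m ∈ 𝒜 m := pw_mem hx m l
        refine step 𝒜 hx hI hJ hJI (hx l) (h1 _ (by omega)) (h2 _ (by push_cast; omega))
          (Submodule.smul_mem _ _ hWI) (hW.smul hm') ?_ ?_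
        · rw [map_smul]; exact Submodule.smul_mem _ _ hDW
        · rw [smul_smul, ← pow_succ']
          convert hE using 1
          push_cast; ring
    exact this t (EvB_pow 𝒜 hx l hWI hW hDW)

end Gr

section Frob
variable {K R : Type*} [Field K] [CommRing R] [Algebra K R]
variable (𝒜 : ℕ → Submodule K R) [GradedAlgebra 𝒜] {n : ℕ}

lemma add_sgn {A : Type*} [CommRing A] (g : A →+ A) (k : ℕ) (a : A) :
    g ((-1) ^ k * a) = (-1) ^ k * g a := by
  rcases neg_one_pow_eq_or A k with h | h <;> rw [h] <;> simp

lemma iter_split {A : Type*} [CommRing A] {p : ℕ} (h : IsFPureRing A p) (e : ℕ) :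
    FSplitsAt A p e 1 := by
  obtain ⟨φ, h1, h2⟩ := h
  induction e with
  | zero => exact ⟨AddMonoidHom.id A, by simp, by simp⟩
  | succ e ih =>
    obtain ⟨ψ, h3, h4⟩ := ih
    refine ⟨φ.comp ψ, fun r x => ?_, by simp [h4, h2]⟩
    have : r ^ p ^ (e + 1) * x = (r ^ p ^ 1) ^ p ^ e * x := by
      rw [← pow_mul, ← pow_add, add_comm]
    rw [this]
    simp only [AddMonoidHom.coe_comp, Function.comp_apply]
    rw [h3, h1]

/-- replace an arbitrary primitive by a homogeneous one -/
lemma homogenize {x : Fin n → R} (hx : ∀ l, x l ∈ 𝒜 1) {J : Ideal R} (hJ : J.IsHomogeneous 𝒜)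
    {t : ℕ} {j : ℤ} {W : Finset (Fin n) → R} (hW : Hg 𝒜 t j W) (c : ℕ) (η : Finset (Fin n) → R)
    (h : tr x c W - D (pw x (t + c)) η ∈ pj n J) : EvB 𝒜 x ⊤ J t j W := by
  refine ⟨c, fun s => zp 𝒜 (j + ((t + c : ℕ) : ℤ) * s.card) (η s), mem_pj.2 fun s => trivial,
    fun s => zp_mem 𝒜 _ _, ?_⟩
  rw [mem_pj] at *
  intro s
  have h1 := zp_ideal 𝒜 hJ (j + ((t + c : ℕ) : ℤ) * s.card) (h s)
  rw [Pi.sub_apply, map_sub, zp_of_mem 𝒜 (Hg.tr hx c hW s), D_apply, map_sum] at h1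
  rw [Pi.sub_apply, D_apply]
  convert h1 using 3 with i hi
  rw [zp_mul 𝒜 (sgn_mem _ (pw_mem hx (t + c) i))]
  have := Finset.card_erase_add_one hi
  rw [← this]; push_cast; ring

lemma frob_base {x : Fin n → R} (hx : ∀ l, x l ∈ 𝒜 1) {J : Ideal R} (hJ : J.IsHomogeneous 𝒜)
    {p : ℕ} (hp : p.Prime) [CharP R p] {A : Type*} [CommRing A] (π : R →+* A)
    (hπ : Function.Surjective π) (hker : ∀ r, π r = 0 ↔ r ∈ J) (hA : IsFPureRing A p)
    (hB : ∃ C : ℤ, ∀ j > C, V 𝒜 x ⊤ J j) {j : ℤ} (hj : 0 < j) : V 𝒜 x ⊤ J j := by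
  haveI : Fact p.Prime := ⟨hp⟩
  obtain ⟨C, hC⟩ := hB
  intro t W _ hW hDW
  set e := C.toNat
  set q := p ^ e with hq
  have hqC : C < q := by
    have : e < p ^ e := Nat.lt_pow_self hp.one_lt
    omega
  have hq0 : 0 < q := pow_pos hp.pos _
  obtain ⟨ψ, h1, h2⟩ := iter_split hA e
  have hz : ∀ {r : R} {k : ℤ}, r ∈ zdeg 𝒜 k → r ^ q ∈ zdeg 𝒜 (q * k) := by
    intro r k hr
    rw [mem_zdeg] at *
    by_cases h0 : 0 ≤ k
    · rw [if_pos h0] at hr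
      rw [if_pos (by positivity)]
      have := SetLike.pow_mem_graded q hr
      have e1 : ((q : ℤ) * k).toNat = q • k.toNat := by
        rw [Int.toNat_mul (by positivity) h0]; simp
      rwa [e1]
    · rw [if_neg h0] at hr
      subst hr
      have : ¬ 0 ≤ (q : ℤ) * k := by
        have : (q : ℤ) * k < 0 := mul_neg_of_pos_of_neg (by exact_mod_cast hq0) (by omega)
        omega
      rw [if_neg this, zero_pow hq0.ne']
  have hWq : Hg 𝒜 (q * t) (q * j) (fun s => W s ^ q) := by
    intro s
    have := hz (hW s)
    convert this using 2
    push_cast; ring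
  have hDWq : D (pw x (q * t)) (fun s => W s ^ q) ∈ pj n J := by
    rw [mem_pj] at *
    intro s
    have : D (pw x (q * t)) (fun s => W s ^ q) s = (D (pw x t) W s) ^ q := by
      rw [D_apply, D_apply, hq, sum_pow_char_pow]
      refine Finset.sum_congr rfl fun i _ => ?_
      have e1 : ((-1 : R) ^ sg i s) ^ p ^ e = (-1) ^ sg i s := by
        rw [← pow_mul, mul_comm, pow_mul, neg_one_pow_char_pow]
      rw [mul_pow, mul_pow, e1, pw, pw, ← pow_mul, mul_comm t]
    rw [this]
    exact J.pow_mem_of_mem (hDW s) _ hq0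
  obtain ⟨c, η, _, _, hη⟩ := hC (q * j) (by nlinarith) _ _ (mem_pj.2 fun s => trivial) hWq hDWq
  have hη2 := tr_mem x (q * c - c) hη
  have hcc : c + (q * c - c) = q * c := by
    have : c ≤ q * c := Nat.le_mul_of_pos_left _ hq0
    omega
  rw [map_sub, tr_tr, tr_D, hcc, add_assoc, hcc] at hη2
  set η' := tr x (q * c - c) η
  choose θ hθ using fun s => hπ (ψ (π (η' s)))
  refine homogenize 𝒜 hx hJ hW c θ ?_
  rw [mem_pj] at *
  intro s
  have h3 := (hker _).2 (hη2 s)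
  rw [← hker]
  simp only [Pi.sub_apply, map_sub, sub_eq_zero, D_apply, tr_apply, map_sum, map_mul, map_pow,
    map_neg, map_one, hθ, pw] at h3 ⊢
  have h4 := congrArg ψ h3
  rw [map_sum] at h4
  have h5 : ψ (π (∏ i ∈ s, x i) ^ (q * c) * π (W s) ^ q) = π (∏ i ∈ s, x i) ^ c * π (W s) := by
    have := h1 (π (∏ i ∈ s, x i) ^ c * π (W s)) 1
    rw [h2, mul_one, mul_one, mul_pow, ← pow_mul, mul_comm c] at this
    exact this
  simp only [map_prod] at h4 h5 ⊢
  rw [← h5, h4]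
  refine Finset.sum_congr rfl fun i _ => ?_
  rw [mul_assoc, add_sgn, ← mul_add, mul_comm q, pow_mul, h1, mul_assoc]

end Frob

section Main
variable {K R : Type*} [Field K] [CommRing R] [Algebra K R]
variable {𝒜 : ℕ → Submodule K R} {n : ℕ}

def Jk {r : ℕ} (f : Fin r → R) (k : ℕ) : Ideal R := Ideal.span (f '' {j | j.val < k})

lemma Jk_succ {r : ℕ} (f : Fin r → R) (k : ℕ) (hk : k < r) :
    Jk f (k + 1) = Jk f k ⊔ Ideal.span {f ⟨k, hk⟩} := by
  unfold Jk
  rw [← Ideal.span_union]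
  congr 1
  ext y
  simp only [Set.mem_image, Set.mem_setOf_eq, Set.mem_union, Set.mem_singleton_iff]
  constructor
  · rintro ⟨a, ha, rfl⟩
    rcases Nat.lt_succ_iff_lt_or_eq.1 ha with h | h
    · exact Or.inl ⟨a, h, rfl⟩
    · right; congr 1; exact Fin.ext h
  · rintro (⟨a, ha, rfl⟩ | rfl)
    · exact ⟨a, by omega, rfl⟩
    · exact ⟨⟨k, hk⟩, by simp, rfl⟩

def ext0 {i : ℕ} (ω : KC n R i) : Finset (Fin n) → R := fun s =>
  if h : s.card = i then ω ⟨s, h⟩ else 0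

lemma kd_eq (f : Fin n → R) (i : ℕ) (η : Finset (Fin n) → R) (s : {s : Finset (Fin n) // s.card = i + 1}) :
    kd R f i (fun u => η u.1) s = D f η s.1 := by
  rw [D_apply, ← Finset.sum_attach]
  simp only [kd, LinearMap.coe_mk, AddHom.coe_mk]
  refine Finset.sum_congr rfl fun a _ => ?_
  rw [zsmul_eq_mul, smul_eq_mul, sg]
  push_cast
  ring

theorem main
    (𝒜 : ℕ → Submodule K R) (hSG : IsStandardGraded K R 𝒜)
    (p : ℕ) (hp : p.Prime) [CharP R p]
    (hFP : IsFPureRing R p)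
    (r : ℕ) (f : Fin r → R) (dg : Fin r → ℕ) (hhom : ∀ k, f k ∈ 𝒜 (dg k))
    (hseq : IsFPureRegSeq R p f)
    (i : ℕ) (j : ℤ) (hj : lcNonzero K R 𝒜 i j) :
    ((∑ k, dg k : ℕ) : ℤ) ≤ -j := by
  classical
  letI : SetLike.GradedMonoid 𝒜 :=
    { one_mem := by rw [hSG.deg0]; exact Submodule.one_le.1 le_rfl
      mul_mem := fun {a b} {x y} hx hy => hSG.mul_le a b (Submodule.mul_mem_mul hx hy) }
  letI : DirectSum.Decomposition 𝒜 := hSG.internal.chooseDecomposition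
  letI : GradedAlgebra 𝒜 := { }
  haveI : Algebra.FiniteType K R := by
    obtain ⟨S, hS⟩ := hSG.fg1
    refine ⟨⟨S, ?_⟩⟩
    rw [← hSG.gen1, ← hS, Algebra.adjoin_span]
  haveI : IsNoetherianRing R := Algebra.FiniteType.isNoetherianRing K R
  obtain ⟨n, x, hx, hspan, t, ω, _, hωZ, hωd, hωB⟩ := hj
  by_contra hcon
  have hm : ∀ d, 0 < d → ∀ a ∈ 𝒜 d, a ∈ Ideal.span (Set.range x) := by
    have hmh : (Ideal.span (Set.range x)).IsHomogeneous 𝒜 := by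
      refine Ideal.homogeneous_span 𝒜 _ ?_
      rintro _ ⟨l, rfl⟩
      exact ⟨1, hx l⟩
    have hall : ∀ a : R, ∃ k : K, a - algebraMap K R k ∈ Ideal.span (Set.range x) := by
      intro a
      have ha : a ∈ Algebra.adjoin K ((𝒜 1 : Submodule K R) : Set R) := by rw [hSG.gen1]; trivial
      induction ha using Algebra.adjoin_induction with
      | mem a ha => exact ⟨0, by rw [map_zero, sub_zero, hspan]; exact Ideal.subset_span ha⟩
      | algebraMap k => exact ⟨k, by simp⟩
      | add a b _ _ h1 h2 =>
        obtain ⟨k, hk⟩ := h1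
        obtain ⟨l, hl⟩ := h2
        refine ⟨k + l, ?_⟩
        convert Ideal.add_mem _ hk hl using 1
        rw [map_add]; ring
      | mul a b _ _ h1 h2 =>
        obtain ⟨k, hk⟩ := h1
        obtain ⟨l, hl⟩ := h2
        refine ⟨k * l, ?_⟩
        convert Ideal.add_mem _ (Ideal.mul_mem_right b _ hk) (Ideal.mul_mem_left _ (algebraMap K R k) hl) using 1
        rw [map_mul]; ring
    intro d hd a ha
    obtain ⟨k, hk⟩ := hall a
    have h1 := hmh d hk
    have h0 : algebraMap K R k ∈ 𝒜 0 := SetLike.algebraMap_mem_graded 𝒜 k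
    rw [DirectSum.decompose_sub, DirectSum.sub_apply, AddSubgroupClass.coe_sub, DirectSum.decompose_of_mem_same _ ha,
      DirectSum.decompose_of_mem_ne _ h0 hd.ne, sub_zero] at h1
    exact h1
  obtain ⟨⟨hreg, htop⟩, hpure⟩ := hseq
  have hJh : ∀ k, (Jk f k).IsHomogeneous 𝒜 := by
    intro k
    refine Ideal.homogeneous_span 𝒜 _ ?_
    rintro _ ⟨l, _, rfl⟩
    exact ⟨_, hhom l⟩
  have hJtop : ∀ k, Jk f k ≠ ⊤ := by
    intro k hk
    refine htop (top_le_iff.1 (hk ▸ ?_))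
    exact Ideal.span_mono (Set.image_subset_range _ _)
  have hset : ∀ k : Fin r, Ideal.span (f '' {j | j < k}) = Jk f k.val := fun k => rfl
  have hdpos : ∀ k, 0 < dg k := by
    intro k
    by_contra h0
    have h1 := hhom k
    rw [show dg k = 0 by omega, hSG.deg0, Submodule.mem_one] at h1
    obtain ⟨c, hc⟩ := h1
    by_cases hc0 : c = 0
    · have := hreg k 1 (by rw [← hc, hc0]; simp)
      rw [hset] at this
      exact hJtop _ ((Ideal.eq_top_iff_one _).2 this)
    · refine htop (Ideal.eq_top_of_isUnit_mem _ (Ideal.subset_span ⟨k, rfl⟩) ?_)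
      rw [← hc]
      exact (IsUnit.mk0 c hc0).map (algebraMap K R)
  have hbd : ∀ k, ∃ C : ℤ, ∀ j > C, V 𝒜 x ⊤ (Jk f k) j := fun k =>
    bounded 𝒜 hx hm Finset.univ ⊤ (Jk f k) (Ideal.IsHomogeneous.top 𝒜) (hJh k) le_top
      (by simp)
  have hlast : ∀ j : ℤ, 0 < j → V 𝒜 x ⊤ (Jk f r) j := by
    intro j hj
    rcases Nat.eq_zero_or_pos r with h0 | h0
    · refine frob_base 𝒜 hx (hJh r) hp (RingHom.id R) Function.surjective_id ?_ hFP (hbd r) hj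
      intro a
      have : {j : Fin r | j.val < r} = ∅ := by
        ext j; exact absurd j.2 (by omega)
      rw [Jk, this, Set.image_empty, Ideal.span_empty, Ideal.mem_bot]
      rfl
    · have hk := hpure ⟨r - 1, by omega⟩
      have : Ideal.span (f '' {j | j ≤ (⟨r - 1, by omega⟩ : Fin r)}) = Jk f r := by
        unfold Jk
        congr 2
        ext j
        have := j.2
        simp only [Set.mem_setOf_eq, Fin.le_def]
        omega
      rw [this] at hk
      exact frob_base 𝒜 hx (hJh r) hp (Ideal.Quotient.mk (Jk f r)) Ideal.Quotient.mk_surjective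
        (fun a => Ideal.Quotient.eq_zero_iff_mem) hk (hbd r) hj
  let dg' : ℕ → ℕ := fun k => if h : k < r then dg ⟨k, h⟩ else 0
  have hmain : ∀ m, m ≤ r → ∀ j : ℤ, -((∑ k ∈ Finset.Ico (r - m) r, dg' k : ℕ) : ℤ) < j →
      V 𝒜 x ⊤ (Jk f (r - m)) j := by
    intro m
    induction m with
    | zero => intro _ j hj; exact hlast j (by simpa using hj)
    | succ m ih =>
      intro hmr
      have hkr : r - (m + 1) < r := by omega
      set k := r - (m + 1) with hkdef
      have hk1 : r - m = k + 1 := by omega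
      rw [hk1] at ih
      have ih := ih (by omega)
      rw [Finset.sum_eq_sum_Ico_succ_bot hkr]
      have hdk : dg' k = dg ⟨k, hkr⟩ := by simp [dg', hkr]
      rw [hdk]
      set y := f ⟨k, hkr⟩ with hy
      set d := dg ⟨k, hkr⟩ with hd
      have hd0 : 0 < d := hdpos _
      obtain ⟨C, hC⟩ := hbd k
      have hstep : ∀ N : ℕ, ∀ j : ℤ, C < j + N → -((d + ∑ k ∈ Finset.Ico (k + 1) r, dg' k : ℕ) : ℤ) < j →
          V 𝒜 x ⊤ (Jk f k) j := by
        intro N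
        induction N with
        | zero => intro j hj _; exact hC j (by simpa using hj)
        | succ N ihN =>
          intro j hjN hj t W hWI hW hDW
          refine step 𝒜 hx (Ideal.IsHomogeneous.top 𝒜) (hJh k) le_top (hhom ⟨k, hkr⟩) ?_ ?_ hWI hW hDW ?_
          · refine V_trivial 𝒜 fun _ _ a ha _ => ?_
            exact hreg ⟨k, hkr⟩ a (mem_col.1 ha.2)
          · rw [Ideal.mul_top, ← Jk_succ]
            refine ih _ ?_
            push_cast at hj ⊢
            omega
          · refine ihN (j + d) (by push_cast at hjN; omega) (by omega) t _ (Submodule.smul_mem _ _ hWI)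
              (hW.smul (hhom _)) ?_
            rw [map_smul]; exact Submodule.smul_mem _ _ hDW
      intro j hj
      exact hstep (C - j + 1).toNat j (by omega) hj
  have hfin := hmain r le_rfl j (by
    have : ∑ k ∈ Finset.Ico (r - r) r, dg' k = ∑ k, dg k := by
      rw [Nat.sub_self, ← Finset.range_eq_Ico, Finset.sum_range]
      simp [dg']
    rw [this]
    omega)
  have hbot : Jk f (r - r) = ⊥ := by simp [Jk]
  rw [hbot] at hfin
  have hωeq : ∀ (s : {s : Finset (Fin n) // s.card = i}), ext0 ω s.1 = ω s := by
    intro s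
    simp [ext0, s.2]
  have hωeq' : (fun u : {s : Finset (Fin n) // s.card = i} => ext0 ω u.1) = ω := funext hωeq
  obtain ⟨c, η, _, _, hη⟩ := hfin t (ext0 ω) (mem_pj.2 fun _ => trivial) (by
      intro s
      unfold ext0
      split_ifs with h
      · have := hωd ⟨s, h⟩
        rwa [h]
      · exact zero_mem _) (by
      rw [mem_pj]
      intro s
      rw [Ideal.mem_bot]
      by_cases h : s.card = i + 1
      · have h1 := kd_eq (pw x t) i (ext0 ω) ⟨s, h⟩
        rw [← h1, hωeq']
        have h2 : kd R (pw x t) i ω = 0 := hωZ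
        rw [h2]; rfl
      · rw [D_apply]
        refine Finset.sum_eq_zero fun a ha => ?_
        have h3 := Finset.card_erase_add_one ha
        rw [ext0, dif_neg (by omega), mul_zero])
  refine hωB c ?_
  rw [mem_pj] at hη
  simp only [Ideal.mem_bot, Pi.sub_apply, sub_eq_zero] at hη
  have htr : ∀ s, ktr R x c i ω s = tr x c (ext0 ω) s.1 := by
    intro s
    rw [tr_apply, hωeq]; rfl
  cases i with
  | zero =>
    change _ ∈ (⊥ : Submodule R _)
    rw [Submodule.mem_bot]
    funext s
    rw [htr, hη, D_apply, Finset.card_eq_zero.1 s.2]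
    simp
  | succ i =>
    refine ⟨fun u => η u.1, ?_⟩
    funext s
    rw [htr, hη]
    exact kd_eq _ i η s

end Main

end FTP

open FT in
/-- Let `(R, m, K)` be a standard graded `K`-algebra of prime
characteristic `p` which is `F`-finite and `F`-pure.  If `f 0, …, f (r-1)` is a
homogeneous `F`-pure regular sequence of degrees `dg 0, …, dg (r-1)`, then
`dg 0 + ⋯ + dg (r-1) ≤ min{-a_i(R) | i ∈ ℕ}` — formalized as: for every `i` and every
degree `j` with `H^i_m(R)_j ≠ 0`, `∑ dg ≤ -j` (with the usual convention
`-a_i(R) = +∞` when `H^i_m(R) = 0`). -/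
theorem sum_degrees_fpureRegSeq_le_min_neg_aInv
    (K R : Type*) [Field K] [CommRing R] [Algebra K R]
    (𝒜 : ℕ → Submodule K R) (hSG : IsStandardGraded K R 𝒜)
    (p : ℕ) (hp : p.Prime) [CharP R p]
    (hFF : IsFFinite R p) (hFP : IsFPureRing R p)
    (r : ℕ) (f : Fin r → R) (dg : Fin r → ℕ) (hhom : ∀ k, f k ∈ 𝒜 (dg k))
    (hseq : IsFPureRegSeq R p f)
    (i : ℕ) (j : ℤ) (hj : lcNonzero K R 𝒜 i j) :
    ((∑ k, dg k : ℕ) : ℤ) ≤ -j := by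
  exact FTP.main 𝒜 hSG p hp hFP r f dg hhom hseq i j hj
end
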